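/- Let d ≥ 2 and set d̃ = d+1. Let φ: R^n → R^m be an R-linear map given by an m×n matrix whose entries are (not necessarily homogeneous) polynomials of degree at most d, and let M = coker(φ). Then the projective dimension of M as an R-module satisfies pd_R(M) ≤ d̃ ↑^{d²+d−2} (d̃^{mn}). -/

import Mathlib

open MvPolynomial

/-- Knuth's up-arrow `knuth a k b = a ↑^k b`, with `a ↑^1 b = a ^ b`,
`a ↑^(k+1) 1 = a` and `a ↑^(k+1) (b+1) = a ↑^k (a ↑^(k+1) b)`. -/
def knuth (a : ℕ) : ℕ → ℕ → ℕ
  | 0, b => a ^ b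
  | 1, b => a ^ b
  | _+2, 0 => 1
  | _+2, 1 => a
  | k+2, b+2 => knuth a (k+1) (knuth a (k+2) (b+1))
  termination_by k b => (k, b)

open CategoryTheory in
/-- The projective dimension of the `R`-module `M` is at most `n`:
there is a projective resolution of `M` vanishing in degrees `> n`. -/
def ProjDimLE (R : Type*) [CommRing R] (M : Type*) [AddCommGroup M] [Module R M]
    (n : ℕ) : Prop :=
  ∃ P : ProjectiveResolution (ModuleCat.of R M),
    ∀ i, n < i → Limits.IsZero (P.complex.X i)

universe v u

section

open scoped KaehlerDifferential TensorProduct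

lemma KaehlerDifferential.span_range_D_eq_top_of_adjoin_eq_top {K L σ : Type*} [Field K] [Field L]
    [Algebra K L] (a : σ → L) (ha : IntermediateField.adjoin K (Set.range a) = ⊤) :
    Submodule.span L (Set.range fun i => KaehlerDifferential.D K L (a i)) = ⊤ := by
  rw [← KaehlerDifferential.span_range_derivation K L]
  refine le_antisymm (Submodule.span_mono ?_) (Submodule.span_le.2 ?_)
  · rintro _ ⟨i, rfl⟩
    exact ⟨a i, rfl⟩
  · rintro _ ⟨x, rfl⟩
    have hx : x ∈ IntermediateField.adjoin K (Set.range a) := ha ▸ IntermediateField.mem_top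
    induction hx using IntermediateField.adjoin_induction with
    | mem x hx =>
      obtain ⟨i, rfl⟩ := hx
      exact Submodule.subset_span ⟨i, rfl⟩
    | algebraMap x => simp
    | add x y _ _ hx hy => simpa using Submodule.add_mem _ hx hy
    | inv x _ hx =>
      rw [Derivation.leibniz_inv]
      exact Submodule.smul_mem _ _ hx
    | mul x y _ _ hx hy =>
      rw [Derivation.leibniz]
      exact Submodule.add_mem _ (Submodule.smul_mem _ _ hy) (Submodule.smul_mem _ _ hx)

lemma exists_formallyEtale_mvPolynomial {K L σ : Type*} [Field K] [PerfectField K] [Field L]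
    [Algebra K L] [Algebra.EssFiniteType K L] [Finite σ] (a : σ → L)
    (ha : IntermediateField.adjoin K (Set.range a) = ⊤) :
    ∃ (τ : Set σ), letI := (aeval (R := K) (fun i : τ => a i)).toAlgebra
      Algebra.FormallyEtale (MvPolynomial τ K) L := by
  obtain ⟨κ, e, he, hspan, hli⟩ := exists_linearIndependent' L
    (fun i => KaehlerDifferential.D K L (a i))
  rw [KaehlerDifferential.span_range_D_eq_top_of_adjoin_eq_top a ha] at hspan
  refine ⟨Set.range e, ?_⟩
  set τ := Set.range e
  let f : κ ≃ τ := Equiv.ofInjective e he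
  have hli' : LinearIndependent L (fun i : τ => KaehlerDifferential.D K L (a i)) := by
    rw [← linearIndependent_equiv f]
    exact hli
  have hspan' : Submodule.span L
      (Set.range (fun i : τ => KaehlerDifferential.D K L (a i))) = ⊤ := by
    rw [← hspan, ← f.surjective.range_comp]
    rfl
  let := (aeval (R := K) (fun i : τ => a i)).toAlgebra
  have : IsScalarTower K (MvPolynomial τ K) L := .of_algHom _
  have hX (i : τ) : algebraMap (MvPolynomial τ K) L (X i) = a i := by
    simp [RingHom.algebraMap_toAlgebra]
  have hunr : Subsingleton (Ω[L⁄MvPolynomial τ K]) := by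
    refine subsingleton_of_forall_eq 0 fun y => ?_
    obtain ⟨x, rfl⟩ := KaehlerDifferential.map_surjective K (MvPolynomial τ K) L y
    have hx : x ∈ Submodule.span L (Set.range (fun i : τ => KaehlerDifferential.D K L (a i))) :=
      hspan' ▸ trivial
    have hle : Submodule.span L (Set.range (fun i : τ => KaehlerDifferential.D K L (a i))) ≤
        (KaehlerDifferential.map K (MvPolynomial τ K) L L).ker := by
      rw [Submodule.span_le]
      rintro _ ⟨i, rfl⟩
      simp only [SetLike.mem_coe, LinearMap.mem_ker, KaehlerDifferential.map_D]
      rw [Algebra.algebraMap_self_apply, ← hX, Derivation.map_algebraMap]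
    exact hle hx
  have hinj : Function.Injective (KaehlerDifferential.mapBaseChange K (MvPolynomial τ K) L) := by
    let b := (KaehlerDifferential.mvPolynomialBasis K τ).baseChange L
    rw [← LinearMap.ker_eq_bot]
    refine LinearMap.ker_eq_bot.2 ?_
    have : LinearIndependent L
        ((KaehlerDifferential.mapBaseChange K (MvPolynomial τ K) L) ∘ b) := by
      convert hli' with i
      simp [b, KaehlerDifferential.mapBaseChange_tmul, hX]
    have hb := b.constr_self L (KaehlerDifferential.mapBaseChange K (MvPolynomial τ K) L)
    rw [← hb]
    exact b.injective_constr_of_linearIndependent (R₂ := L) this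
  have hH1 : Subsingleton (Algebra.H1Cotangent (MvPolynomial τ K) L) := by
    refine subsingleton_of_forall_eq 0 fun y => ?_
    have : Subsingleton (Algebra.H1Cotangent K L) := Algebra.FormallySmooth.subsingleton_h1Cotangent
    have h1 : Algebra.H1Cotangent.δ K (MvPolynomial τ K) L y = 0 :=
      hinj (((Algebra.H1Cotangent.exact_δ_mapBaseChange K (MvPolynomial τ K) L) _).2 ⟨y, rfl⟩
        |>.trans (map_zero _).symm)
    obtain ⟨z, rfl⟩ := ((Algebra.H1Cotangent.exact_map_δ K (MvPolynomial τ K) L) y).1 h1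
    rw [Subsingleton.elim z 0, map_zero]
  exact ⟨hunr, hH1⟩

end

section

open scoped KaehlerDifferential TensorProduct

lemma trdeg_le_natCard_of_formallyUnramified_mvPolynomial {K L ι : Type*} [Field K] [Field L]
    [Algebra K L] [Algebra.EssFiniteType K L] [Finite ι] (a : ι → L)
    (h : letI := (aeval (R := K) a).toAlgebra
      Algebra.FormallyUnramified (MvPolynomial ι K) L) :
    Algebra.trdeg K L ≤ Nat.card ι := by
  let := (aeval (R := K) a).toAlgebra
  let F := IntermediateField.adjoin K (Set.range a)
  let φ : MvPolynomial ι K →ₐ[K] F :=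
    aeval fun i => ⟨a i, IntermediateField.subset_adjoin K _ ⟨i, rfl⟩⟩
  let := φ.toAlgebra
  have : IsScalarTower (MvPolynomial ι K) F L := by
    refine .of_algebraMap_eq' ?_
    have : aeval (R := K) a = (IntermediateField.val F).comp φ := by
      ext i
      simp [φ]
    exact congrArg AlgHom.toRingHom this
  have : Algebra.FormallyUnramified F L := .of_restrictScalars (MvPolynomial ι K) F L
  have : Algebra.EssFiniteType F L := .of_comp K F L
  have : Algebra.IsSeparable F L := Algebra.FormallyUnramified.isSeparable F L
  have : Algebra.IsAlgebraic (Algebra.adjoin K (Set.range a)) L :=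
    IntermediateField.isAlgebraic_adjoin_iff_top.1 inferInstance
  refine (Algebra.IsAlgebraic.trdeg_le_cardinalMk K (Set.range a)).trans ?_
  rw [← Nat.cast_card (α := Set.range a)]
  exact_mod_cast Nat.card_le_card_of_surjective _ Set.rangeFactorization_surjective

lemma exists_truncated_lift {K L σ : Type*} [Field K] [PerfectField K] [Field L]
    [Algebra K L] [Algebra.EssFiniteType K L] [Finite σ] (a : σ → L)
    (ha : IntermediateField.adjoin K (Set.range a) = ⊤) (D : ℕ) :
    ∃ (τ : Set σ) (ψ : σ → MvPolynomial τ L), Algebra.trdeg K L ≤ Nat.card τ ∧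
      (∀ i, constantCoeff (ψ i) = a i) ∧ (∀ i : τ, ψ i = C (a i) + X i) ∧
      ∀ f : MvPolynomial σ K, aeval a f = 0 → aeval ψ f ∈ idealOfVars τ L ^ (D + 1) := by
  obtain ⟨τ, hτ⟩ := exists_formallyEtale_mvPolynomial (K := K) a ha
  let := (aeval (R := K) (fun i : τ => a i)).toAlgebra
  let I := idealOfVars τ L ^ (D + 1)
  let B := MvPolynomial τ L ⧸ I
  let q : MvPolynomial τ L →ₐ[K] B := Ideal.Quotient.mkₐ K I
  have hq : Function.Surjective q := Ideal.Quotient.mk_surjective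
  let j : MvPolynomial τ K →ₐ[K] B := aeval fun i => q (C (a i) + X i)
  let := j.toAlgebra
  have hI (x : MvPolynomial τ L) (hx : x ∈ idealOfVars τ L) : constantCoeff x = 0 := by
    rw [← pow_one (idealOfVars τ L), mem_pow_idealOfVars_iff'] at hx
    exact hx 0 (by simp)
  let g₀ : B →+* L := Ideal.Quotient.lift I constantCoeff fun x hx =>
    hI x (Ideal.pow_le_self (Nat.succ_ne_zero D) hx)
  have hg₀ (x : MvPolynomial τ L) : g₀ (q x) = constantCoeff x := rfl
  let g : B →ₐ[MvPolynomial τ K] L :=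
    { g₀ with
      commutes' := fun r => by
        change g₀ (j r) = aeval (R := K) (fun i : τ => a i) r
        rw [aeval_def, ← coe_eval₂Hom]
        refine congrArg (fun f : MvPolynomial τ K →+* L => f r)
          (MvPolynomial.ringHom_ext (f := g₀.comp j.toRingHom) ?_ ?_)
        · intro c
          have : j (C c) = q (C (algebraMap K L c)) := j.commutes c
          simp [this, hg₀]
        · intro i
          simp [j, -map_add, hg₀]
          simp }
  have hg : Function.Surjective g := fun x => ⟨q (C x), by
    change g₀ _ = _
    simp [hg₀]⟩
  have hker : IsNilpotent (RingHom.ker (g : B →+* L)) := by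
    refine ⟨D + 1, ?_⟩
    have : RingHom.ker (g : B →+* L) ≤ (idealOfVars τ L).map q := by
      intro y hy
      obtain ⟨y, rfl⟩ := hq y
      refine Ideal.mem_map_of_mem _ ?_
      rw [← pow_one (idealOfVars τ L), mem_pow_idealOfVars_iff']
      intro x hx
      obtain rfl : x = 0 := (Finsupp.degree_eq_zero_iff x).1 (by simpa using hx)
      exact hy
    rw [Ideal.zero_eq_bot, eq_bot_iff]
    refine (Ideal.pow_right_mono this _).trans ?_
    rw [← Ideal.map_pow, Ideal.map_le_iff_le_comap]
    intro x hx
    exact Ideal.Quotient.eq_zero_iff_mem.2 hx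
  let φ := Algebra.FormallySmooth.liftOfSurjective (AlgHom.id (MvPolynomial τ K) L) g hg hker
  have hφ (x : L) : g (φ x) = x :=
    Algebra.FormallySmooth.liftOfSurjective_apply (AlgHom.id (MvPolynomial τ K) L) g hg hker x
  have hφj (r : MvPolynomial τ K) : φ (aeval (fun i : τ => a i) r) = j r := φ.commutes r
  have hφX (i : τ) : φ (a i) = q (C (a i) + X i) := by
    simpa [j, -map_add] using hφj (X i)
  classical
  let ψ : σ → MvPolynomial τ L := fun i =>
    if h : i ∈ τ then C (a i) + X ⟨i, h⟩ else (hq (φ (a i))).choose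
  have hψ (i : σ) : q (ψ i) = φ (a i) := by
    by_cases h : i ∈ τ
    · simpa only [ψ, dif_pos h] using (hφX ⟨i, h⟩).symm
    · simpa only [ψ, dif_neg h] using (hq (φ (a i))).choose_spec
  refine ⟨τ, ψ, trdeg_le_natCard_of_formallyUnramified_mvPolynomial (fun i : τ => a i)
    inferInstance, fun i => ?_,
    fun i => ?_, fun f hf => ?_⟩
  · rw [← hg₀, hψ]
    exact hφ _
  · simp [ψ]
  · refine Ideal.Quotient.eq_zero_iff_mem.1 ?_
    change q (aeval ψ f) = 0
    have : q (aeval ψ f) = φ (aeval a f) := by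
      refine congrArg (fun F : MvPolynomial σ K →+* B => F f)
        (MvPolynomial.ringHom_ext (f := (q.comp (aeval ψ)).toRingHom)
          (g := φ.toRingHom.comp (aeval a).toRingHom) (fun c => ?_) fun i => ?_)
      · have := hφj (C c)
        simp only [algHom_C] at this
        simp [this]
      · simp [hψ]
    rw [this, hf, map_zero]

end

/-- The form `F` of degree `e` is a sum of at most `B` products of two forms of positive degrees
adding up to `e`. -/
def StrengthLE {σ K : Type*} [CommRing K] (e B : ℕ) (F : MvPolynomial σ K) : Prop :=
  ∃ n ≤ B, ∃ (g h : Fin n → MvPolynomial σ K) (a b : Fin n → ℕ),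
    (∀ i, 0 < a i ∧ 0 < b i ∧ a i + b i = e ∧
      (g i).IsHomogeneous (a i) ∧ (h i).IsHomogeneous (b i)) ∧ F = ∑ i, g i * h i

section

variable {L σ : Type*} [Field L]

lemma StrengthLE.of_fintype {ι : Type*} [Fintype ι] {e B : ℕ} (hB : Fintype.card ι ≤ B)
    (g h : ι → MvPolynomial σ L) (a b : ι → ℕ)
    (H : ∀ i, 0 < a i ∧ 0 < b i ∧ a i + b i = e ∧
      (g i).IsHomogeneous (a i) ∧ (h i).IsHomogeneous (b i)) :
    StrengthLE e B (∑ i, g i * h i) := by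
  let ε := (Fintype.equivFin ι).symm
  refine ⟨_, hB, g ∘ ε, h ∘ ε, a ∘ ε, b ∘ ε, fun i => H _, ?_⟩
  exact (Equiv.sum_comp ε fun i => g i * h i).symm

lemma coeff_aeval_add_monomial (a : σ → L) (m m' : σ →₀ ℕ) (h : m.degree ≤ m'.degree) :
    coeff m' (aeval (fun i => C (a i) + X i : σ → MvPolynomial σ L) (monomial m (1 : L))) =
      coeff m' (monomial m (1 : L)) := by
  classical
  induction hn : m.degree generalizing m m' with
  | zero =>
    obtain rfl := (Finsupp.degree_eq_zero_iff m).1 hn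
    simp [coeff_one]
  | succ n ih =>
    obtain ⟨i, hi⟩ : ∃ i, m i ≠ 0 := by
      by_contra! hm
      have : m = 0 := Finsupp.ext hm
      simp [this] at hn
    obtain ⟨m, rfl⟩ : ∃ k, m = k + Finsupp.single i 1 :=
      ⟨m - Finsupp.single i 1, (tsub_add_cancel_of_le (by simpa [Nat.one_le_iff_ne_zero])).symm⟩
    have hm : m.degree = n := by simpa using hn
    rw [← mul_one (1 : L), ← monomial_mul, ← X, map_mul, aeval_X, mul_add, coeff_add,
      coeff_mul_X', coeff_mul_X', mul_comm _ (C _), coeff_C_mul,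
      ih m m' (by omega) hm, coeff_monomial, if_neg (by rintro rfl; omega), mul_zero, zero_add]
    split_ifs with hi'
    · refine ih m _ ?_ hm
      have : Finsupp.single i 1 ≤ m' := by
        simpa [Nat.one_le_iff_ne_zero] using hi'
      obtain ⟨k, rfl⟩ := le_iff_exists_add.1 this
      simp at h ⊢
      omega
    · rfl

lemma coeff_aeval_add (a : σ → L) (f : MvPolynomial σ L) (n : ℕ) (hf : f.IsHomogeneous n)
    (m' : σ →₀ ℕ) (h : n ≤ m'.degree) :
    coeff m' (aeval (fun i => C (a i) + X i : σ → MvPolynomial σ L) f) = coeff m' f := by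
  have : f = ∑ m ∈ f.support, coeff m f • monomial m (1 : L) := by
    conv_lhs => rw [f.as_sum]
    simp [smul_monomial]
  conv_rhs => rw [this]
  conv_lhs => rw [this]
  simp only [map_sum, map_smul, coeff_sum, coeff_smul]
  refine Finset.sum_congr rfl fun m hm => ?_
  rw [coeff_aeval_add_monomial _ _ _ (le_of_eq_of_le ?_ h)]
  exact (hf.degree_eq_sum_deg_support hm).symm

lemma sub_sub_mem_idealOfVars_sq [Fintype σ] (G : MvPolynomial σ L) :
    G - C (coeff 0 G) - ∑ i, C (coeff (Finsupp.single i 1) G) * X i ∈ idealOfVars σ L ^ 2 := by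
  classical
  rw [mem_pow_idealOfVars_iff']
  intro x hx
  by_cases h0 : x = 0
  · subst h0
    rw [coeff_sub, coeff_sub, coeff_sum, Finset.sum_eq_zero fun i _ => by simp]
    simp
  · obtain ⟨i, hi⟩ : ∃ i, x i ≠ 0 := by
      by_contra! hm
      exact h0 (Finsupp.ext hm)
    obtain ⟨k, rfl⟩ : ∃ k, x = k + Finsupp.single i 1 :=
      ⟨x - Finsupp.single i 1, (tsub_add_cancel_of_le (by simpa [Nat.one_le_iff_ne_zero])).symm⟩
    have : k.degree = 0 := by simp at hx; omega
    obtain rfl := (Finsupp.degree_eq_zero_iff k).1 this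
    rw [zero_add] at h0 ⊢
    simp [coeff_sum, coeff_C, coeff_X, Finsupp.single_left_inj, Ne.symm h0]

lemma homogeneousComponent_add_mul {g : MvPolynomial σ L} {m : ℕ} (hg : g.IsHomogeneous m)
    (n : ℕ) (h : MvPolynomial σ L) :
    homogeneousComponent (m + n) (g * h) = g * homogeneousComponent n h := by
  conv_lhs => rw [← sum_homogeneousComponent h, Finset.mul_sum, map_sum]
  have (i : ℕ) : homogeneousComponent (m + n) (g * homogeneousComponent i h) =
      if i = n then g * homogeneousComponent n h else 0 := by
    rw [homogeneousComponent_of_mem (hg.mul (homogeneousComponent_isHomogeneous i h))]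
    split_ifs with h1 h2 h2
    · rw [h2]
    · omega
    · omega
    · rfl
  simp only [this, Finset.sum_ite_eq', Finset.mem_range]
  split_ifs with h1
  · rfl
  · rw [homogeneousComponent_eq_zero _ _ (by omega), mul_zero]

lemma homogeneousComponent_eq_zero_of_mem {n e : ℕ} {p : MvPolynomial σ L}
    (hp : p ∈ idealOfVars σ L ^ n) (h : e < n) : homogeneousComponent e p = 0 := by
  rw [mem_pow_idealOfVars_iff'] at hp
  ext m
  rw [coeff_homogeneousComponent, coeff_zero]
  split_ifs with hm
  · exact hp m (hm ▸ h)
  · rfl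

lemma aeval_mem_pow_idealOfVars {y : σ → MvPolynomial σ L} (hy : ∀ i, y i ∈ idealOfVars σ L)
    {n : ℕ} {p : MvPolynomial σ L} (hp : p ∈ idealOfVars σ L ^ n) :
    aeval y p ∈ idealOfVars σ L ^ n := by
  have : idealOfVars σ L ≤ (idealOfVars σ L).comap (aeval (R := L) y) := by
    rw [idealOfVars, Ideal.span_le]
    rintro _ ⟨i, rfl⟩
    simpa using hy i
  exact Ideal.le_comap_pow _ _ (Ideal.pow_right_mono this n hp)

end

section

variable {L σ : Type*} [Field L]

lemma aeval_sub_mem_sup {y : σ → MvPolynomial σ L} (hy : ∀ i, y i ∈ idealOfVars σ L)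
    {J : Ideal (MvPolynomial σ L)} {e : ℕ} (hJ : ∀ i, y i - X i ∈ J ⊔ idealOfVars σ L ^ e)
    {p : MvPolynomial σ L} (hp : p ∈ idealOfVars σ L ^ 2) :
    aeval y p - p ∈ J ⊔ idealOfVars σ L ^ (e + 1) := by
  set n := idealOfVars σ L with hn
  have key (g : MvPolynomial σ L) : aeval y g - g ∈ J ⊔ n ^ e := by
    rw [← Ideal.Quotient.mk_eq_mk_iff_sub_mem]
    refine congrArg (fun F : MvPolynomial σ L →+* _ => F g)
        (MvPolynomial.ringHom_ext (f := (Ideal.Quotient.mk (J ⊔ n ^ e)).comp (aeval y).toRingHom)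
          (g := Ideal.Quotient.mk (J ⊔ n ^ e)) (fun c => ?_) fun i => ?_)
    · simp
    · simpa using (Ideal.Quotient.mk_eq_mk_iff_sub_mem _ _).2 (hJ i)
  have mul_mem {r s : MvPolynomial σ L} (hr : r ∈ n) (hs : s ∈ J ⊔ n ^ e) :
      r * s ∈ J ⊔ n ^ (e + 1) := by
    have := Ideal.mul_mem_mul hr hs
    rw [Ideal.mul_sup, ← pow_succ'] at this
    exact (sup_le_sup_right (Ideal.mul_le_right : n * J ≤ J) _ : _ ≤ J ⊔ n ^ (e + 1)) this
  rw [pow_two] at hp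
  induction hp using Submodule.mul_induction_on' with
  | mem_mul_mem r hr s hs =>
    have hr' : aeval y r ∈ n := by
      simpa using aeval_mem_pow_idealOfVars hy (n := 1) (by simpa using hr)
    have : aeval y (r * s) - r * s = aeval y r * (aeval y s - s) + s * (aeval y r - r) := by
      rw [map_mul]; ring
    rw [this]
    exact add_mem (mul_mem hr' (key s)) (mul_mem hs (key r))
  | add r _ s _ hr hs =>
    rw [map_add, add_sub_add_comm]
    exact add_mem hr hs

lemma exists_strengthLE_of_mem_sup {ι : Type*} [Fintype ι] {G : MvPolynomial σ L} {e B : ℕ}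
    (hB : Fintype.card ι ≤ B)
    (g : ι → MvPolynomial σ L) (a : ι → ℕ) (ha : ∀ i, 0 < a i ∧ a i < e)
    (hg : ∀ i, (g i).IsHomogeneous (a i))
    (hG : G ∈ Ideal.span (Set.range g) ⊔ idealOfVars σ L ^ (e + 1)) :
    StrengthLE e B (homogeneousComponent e G) := by
  obtain ⟨p, hp, q, hq, rfl⟩ := Submodule.mem_sup.1 hG
  obtain ⟨h, rfl⟩ := (Submodule.mem_span_range_iff_exists_fun _).1 hp
  rw [map_add, homogeneousComponent_eq_zero_of_mem hq (Nat.lt_succ_self e), add_zero, map_sum]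
  have (i : ι) : homogeneousComponent e (h i • g i) =
      g i * homogeneousComponent (e - a i) (h i) := by
    rw [← homogeneousComponent_add_mul (hg i), smul_eq_mul, mul_comm,
      Nat.add_sub_cancel' (ha i).2.le]
  simp only [this]
  refine StrengthLE.of_fintype hB _ _ a (fun i => e - a i) fun i => ⟨(ha i).1, ?_, ?_, hg i,
    homogeneousComponent_isHomogeneous _ _⟩
  · have := ha i; omega
  · have := ha i; omega

end

section

variable {L σ : Type*} [Field L]

lemma coeff_single_aeval [Fintype σ] {y : σ → MvPolynomial σ L}
    (hy : ∀ i, y i ∈ idealOfVars σ L) (G : MvPolynomial σ L) (t : σ) :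
    coeff (Finsupp.single t 1) (aeval y G) =
      ∑ i, coeff (Finsupp.single i 1) G * coeff (Finsupp.single t 1) (y i) := by
  have h := aeval_mem_pow_idealOfVars hy (sub_sub_mem_idealOfVars_sq G)
  rw [mem_pow_idealOfVars_iff'] at h
  have := h (Finsupp.single t 1) (by simp)
  rw [map_sub, map_sub, coeff_sub, coeff_sub, sub_sub, sub_eq_zero] at this
  rw [this]
  classical
  have h0 : (0 : σ →₀ ℕ) ≠ Finsupp.single t 1 := by simp [eq_comm]
  simp [coeff_sum, coeff_C, h0]

lemma exists_linearCombination_coeff_eq_zero {κ : Type*} [Fintype κ] [Finite σ]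
    {τ : Set σ} {y : σ → MvPolynomial σ L} (hy : ∀ i, y i ∈ idealOfVars σ L)
    (hyτ : ∀ i ∈ τ, y i = X i) (F : κ → MvPolynomial σ L)
    (hF : ∀ k, aeval y (F k) ∈ idealOfVars σ L ^ 2)
    (hcard : Nat.card ↥τᶜ < Fintype.card κ) :
    ∃ c : κ → L, c ≠ 0 ∧ ∀ i, coeff (Finsupp.single i 1) (∑ k, c k • F k) = 0 := by
  classical
  have := Fintype.ofFinite σ
  let Φ : (κ → L) →ₗ[L] (↥τᶜ → L) :=
    { toFun := fun c i => coeff (Finsupp.single i.1 1) (∑ k, c k • F k)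
      map_add' := fun c c' => by
        ext i; simp [add_smul, Finset.sum_add_distrib]
      map_smul' := fun r c => by
        ext i; simp [coeff_sum, Finset.mul_sum, mul_assoc] }
  obtain ⟨c, hc, hc0⟩ := Submodule.exists_mem_ne_zero_of_ne_bot
    (LinearMap.ker_ne_bot_of_finrank_lt (f := Φ) (by simpa using hcard))
  refine ⟨c, hc0, ?_⟩
  have hcompl (i : σ) (hi : i ∉ τ) : coeff (Finsupp.single i 1) (∑ k, c k • F k) = 0 :=
    congrFun hc ⟨i, hi⟩
  intro t
  by_cases ht : t ∈ τ
  · have h1 : aeval y (∑ k, c k • F k) ∈ idealOfVars σ L ^ 2 := by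
      rw [map_sum]
      refine Ideal.sum_mem _ fun k _ => ?_
      rw [map_smul]
      exact Submodule.smul_of_tower_mem _ _ (hF k)
    rw [mem_pow_idealOfVars_iff'] at h1
    have h2 := h1 (Finsupp.single t 1) (by simp)
    rw [coeff_single_aeval hy, Finset.sum_eq_single t] at h2
    · simpa [hyτ t ht] using h2
    · intro i _ hi
      by_cases hi' : i ∈ τ
      · rw [hyτ i hi', coeff_X, if_neg, mul_zero]
        simpa [Finsupp.single_left_inj] using hi
      · rw [hcompl i hi', zero_mul]
    · simp
  · exact hcompl t ht

lemma homogeneousComponent_aeval_add (a : σ → L) {f : MvPolynomial σ L} {n : ℕ}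
    (hf : f.IsHomogeneous n) {e : ℕ} (he : n ≤ e) :
    homogeneousComponent e (aeval (fun i => C (a i) + X i : σ → MvPolynomial σ L) f) =
      if n = e then f else 0 := by
  have : homogeneousComponent e (aeval (fun i => C (a i) + X i : σ → MvPolynomial σ L) f) =
      homogeneousComponent e f := by
    ext m
    simp only [coeff_homogeneousComponent]
    split_ifs with hm
    · exact coeff_aeval_add a f n hf m (hm ▸ he)
    · rfl
  rw [this, homogeneousComponent_of_mem hf]
  simp [eq_comm]

theorem exists_linearCombination_strengthLE {κ : Type*} [Fintype κ] [Finite σ] {τ : Set σ}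
    {a : σ → L} {ψ : σ → MvPolynomial τ L} (hψ : ∀ i, constantCoeff (ψ i) = a i)
    (hψτ : ∀ i : τ, ψ i = C (a i) + X i) {f : κ → MvPolynomial σ L} {d : κ → ℕ}
    (hf : ∀ k, (f k).IsHomogeneous (d k)) (hd : ∀ k, 0 < d k) {D : ℕ} (hD : ∀ k, d k ≤ D)
    (hψf : ∀ k, aeval ψ (f k) ∈ idealOfVars τ L ^ (D + 1))
    (hcard : Nat.card ↥τᶜ < Fintype.card κ) :
    ∃ (k₀ : κ) (c : κ → L), c k₀ = 1 ∧ (∀ k, c k ≠ 0 → d k = d k₀) ∧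
      StrengthLE (d k₀) (Nat.card ↥τᶜ * (d k₀ - 1)) (∑ k, c k • f k) := by
  classical
  have := Fintype.ofFinite σ
  set n := idealOfVars σ L with hn
  let y : σ → MvPolynomial σ L := fun i => rename (↑) (ψ i) - C (a i)
  let F : κ → MvPolynomial σ L := fun k => aeval (fun i => C (a i) + X i) (f k)
  have hy (i : σ) : y i ∈ n := by
    rw [← pow_one n, mem_pow_idealOfVars_iff']
    intro x hx
    obtain rfl : x = 0 := (Finsupp.degree_eq_zero_iff x).1 (by simpa using hx)
    rw [coeff_sub, ← hψ, ← constantCoeff_eq, constantCoeff_rename]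
    simp
  have hyτ (i : σ) (hi : i ∈ τ) : y i = X i := by
    have := hψτ ⟨i, hi⟩
    simp only at this
    simp [y, this]
  have hFn (k : κ) : aeval y (F k) ∈ n ^ (D + 1) := by
    have h1 : aeval y (F k) = rename (↑) (aeval ψ (f k)) := by
      have : ((aeval y).comp (aeval fun i => C (a i) + X i) : MvPolynomial σ L →ₐ[L] _) =
          (rename (↑)).comp (aeval ψ) := by
        ext i
        simp [y]
      exact DFunLike.congr_fun this (f k)
    rw [h1]
    have h2 : idealOfVars τ L ≤ n.comap (rename (R := L) (Subtype.val : τ → σ)) := by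
      rw [idealOfVars, Ideal.span_le]
      rintro _ ⟨i, rfl⟩
      simpa using (Ideal.subset_span (Set.mem_range_self i.1) : (X i.1 : MvPolynomial σ L) ∈ _)
    exact Ideal.le_comap_pow _ _ (Ideal.pow_right_mono h2 _ (hψf k))
  have hκ : Nonempty κ := Fintype.card_pos_iff.1 (Nat.zero_lt_of_lt hcard)
  have hD1 : 1 ≤ D := (hd hκ.some).trans_le (hD _)
  obtain ⟨c, hc0, hc⟩ := exists_linearCombination_coeff_eq_zero hy hyτ F
    (fun k => Ideal.pow_le_pow_right (by omega) (hFn k)) hcard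
  obtain ⟨k₀, hk₀, hmax⟩ := (Finset.univ.filter fun k => c k ≠ 0).exists_max_image d (by
    obtain ⟨k, hk⟩ := Function.ne_iff.1 hc0
    exact ⟨k, by simpa using hk⟩)
  simp only [Finset.mem_filter, Finset.mem_univ, true_and] at hk₀ hmax
  set e := d k₀ with he
  let c' : κ → L := fun k => if d k = e then (c k₀)⁻¹ * c k else 0
  refine ⟨k₀, c', by simp [c', he, hk₀], fun k hk => by
    by_contra h
    exact hk (if_neg h), ?_⟩
  set G := ∑ k, ((c k₀)⁻¹ * c k) • F k with hG
  have hG1 (i : σ) : coeff (Finsupp.single i 1) G = 0 := by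
    have : G = (c k₀)⁻¹ • ∑ k, c k • F k := by simp [hG, Finset.smul_sum, mul_smul]
    rw [this, coeff_smul, hc, smul_zero]
  have hcomp : homogeneousComponent e G = ∑ k, c' k • f k := by
    rw [hG, map_sum]
    refine Finset.sum_congr rfl fun k _ => ?_
    by_cases hck : c k = 0
    · simp [c', hck]
    · rw [map_smul, homogeneousComponent_aeval_add a (hf k) (hmax k hck)]
      simp [c']
  have hG2 : G - C (coeff 0 G) ∈ n ^ 2 := by
    simpa [hG1] using sub_sub_mem_idealOfVars_sq G
  have hGy : aeval y G ∈ n ^ (e + 1) := by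
    rw [hG, map_sum]
    refine Ideal.sum_mem _ fun k _ => ?_
    rw [map_smul]
    exact Submodule.smul_of_tower_mem _ _ (Ideal.pow_le_pow_right (by have := hD k₀; omega) (hFn k))
  let g : ↥τᶜ × Fin (e - 1) → MvPolynomial σ L := fun p =>
    homogeneousComponent (p.2 + 1) (y p.1 - X p.1.1 : MvPolynomial σ L)
  let J := Ideal.span (Set.range g)
  have hJ (i : σ) : y i - X i ∈ J ⊔ n ^ e := by
    by_cases hi : i ∈ τ
    · simp [hyτ i hi]
    have hz : y i - X i ∈ n := sub_mem (hy i) (Ideal.subset_span (Set.mem_range_self i))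
    rw [← add_sub_cancel (∑ j : Fin (e - 1), g (⟨i, hi⟩, j)) (y i - X i)]
    refine add_mem (Ideal.mem_sup_left (Ideal.sum_mem _ fun j _ =>
      Ideal.subset_span (Set.mem_range_self _))) (Ideal.mem_sup_right ?_)
    rw [mem_pow_idealOfVars_iff']
    intro x hx
    rw [coeff_sub, sub_eq_zero, coeff_sum]
    simp only [g, coeff_homogeneousComponent]
    by_cases hx0 : x.degree = 0
    · rw [← pow_one n, mem_pow_idealOfVars_iff'] at hz
      rw [hz x (by omega)]
      simp
    · rw [Finset.sum_eq_single ⟨x.degree - 1, by omega⟩, if_pos]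
      · simp only; omega
      · rintro j - hj
        refine if_neg fun h => hj (Fin.ext ?_)
        simp [h]
      · simp
  rw [← hcomp]
  have hGJ : G ∈ J ⊔ n ^ (e + 1) := by
    have h1 := aeval_sub_mem_sup hy hJ hG2
    have h2 := sub_mem (show aeval y G ∈ J ⊔ n ^ (e + 1) from Ideal.mem_sup_right hGy) h1
    simpa using h2
  refine exists_strengthLE_of_mem_sup (by simp [← he]) g (fun p => p.2 + 1)
    (fun p => ⟨Nat.succ_pos _, ?_⟩)
    (fun p => homogeneousComponent_isHomogeneous _ (y p.1.1 - X p.1.1)) hGJ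
  have := p.2.2
  omega

end

lemma nonempty_algHom_of_finiteType (K A : Type*) [Field K] [IsAlgClosed K] [CommRing A]
    [Nontrivial A] [Algebra K A] [Algebra.FiniteType K A] : Nonempty (A →ₐ[K] K) := by
  obtain ⟨m, hm⟩ := Ideal.exists_maximal A
  let := Ideal.Quotient.field m
  have := finite_of_finite_type_of_isJacobsonRing K (A ⧸ m)
  let e : K ≃ₐ[K] A ⧸ m := AlgEquiv.ofBijective (Algebra.ofId K (A ⧸ m))
    (IsAlgClosed.algebraMap_bijective_of_isIntegral)
  exact ⟨(e.symm : (A ⧸ m) →ₐ[K] K).comp (Ideal.Quotient.mkₐ K m)⟩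

lemma StrengthLE.mono {σ L : Type*} [CommRing L] {e B B' : ℕ} {F : MvPolynomial σ L}
    (h : StrengthLE e B F) (hB : B ≤ B') : StrengthLE e B' F := by
  obtain ⟨n, hn, h⟩ := h
  exact ⟨n, hn.trans hB, h⟩

lemma StrengthLE.map {σ A L : Type*} [CommRing A] [CommRing L] {e B : ℕ} {F : MvPolynomial σ A}
    (φ : A →+* L) (h : StrengthLE e B F) : StrengthLE e B (MvPolynomial.map φ F) := by
  obtain ⟨n, hn, g, h, a, b, H, rfl⟩ := h
  refine ⟨n, hn, fun i => MvPolynomial.map φ (g i), fun i => MvPolynomial.map φ (h i), a, b,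
    fun i => ?_, by simp⟩
  obtain ⟨h1, h2, h3, h4, h5⟩ := H i
  exact ⟨h1, h2, h3, h4.map _, h5.map _⟩

/-- Over an algebraically closed field, linear combinations of bounded strength descend along
field extensions. -/
lemma exists_linearCombination_strengthLE_of_map {K L σ κ : Type*} [Field K] [IsAlgClosed K]
    [Field L] [Algebra K L] [Fintype κ] {f : κ → MvPolynomial σ K} {e B : ℕ} (k₀ : κ) (c : κ → L)
    (hc : c k₀ = 1)
    (h : StrengthLE e B (∑ k, c k • MvPolynomial.map (algebraMap K L) (f k))) :
    ∃ c' : κ → K, c' k₀ = 1 ∧ (∀ k, c k = 0 → c' k = 0) ∧ StrengthLE e B (∑ k, c' k • f k) := by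
  classical
  obtain ⟨n, hn, g, h, a, b, H, hF⟩ := h
  let s : Finset L := Finset.univ.image c ∪ Finset.univ.biUnion (fun i => (g i).coeffs) ∪
    Finset.univ.biUnion (fun i => (h i).coeffs)
  let A := Algebra.adjoin K (s : Set L)
  have : Algebra.FiniteType K A :=
    (Subalgebra.fg_iff_finiteType _).1 (Subalgebra.fg_adjoin_finset s)
  obtain ⟨φ⟩ := nonempty_algHom_of_finiteType K A
  have hs : ∀ x ∈ s, x ∈ A := fun x hx => Algebra.subset_adjoin (by simpa using hx)
  have hcA : ∀ k, c k ∈ A := fun k => hs _ (by simp [s])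
  have hgA : ∀ i, ∃ p : MvPolynomial σ A, MvPolynomial.map (algebraMap A L) p = g i := by
    intro i
    refine mem_range_map_iff_coeffs_subset.2 fun x hx => ⟨⟨x, hs _ ?_⟩, rfl⟩
    simp only [s, Finset.mem_union, Finset.mem_biUnion]
    exact Or.inl (Or.inr ⟨i, Finset.mem_univ _, hx⟩)
  have hhA : ∀ i, ∃ p : MvPolynomial σ A, MvPolynomial.map (algebraMap A L) p = h i := by
    intro i
    refine mem_range_map_iff_coeffs_subset.2 fun x hx => ⟨⟨x, hs _ ?_⟩, rfl⟩
    simp only [s, Finset.mem_union, Finset.mem_biUnion]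
    exact Or.inr ⟨i, Finset.mem_univ _, hx⟩
  choose g' hg' using hgA
  choose h' hh' using hhA
  have hinj : Function.Injective (algebraMap A L) := Subtype.val_injective
  have hA : StrengthLE e B (∑ k, (⟨c k, hcA k⟩ : A) • MvPolynomial.map (algebraMap K A) (f k)) := by
    refine ⟨n, hn, g', h', a, b, fun i => ?_, ?_⟩
    · obtain ⟨h1, h2, h3, h4, h5⟩ := H i
      rw [← hg'] at h4
      rw [← hh'] at h5
      exact ⟨h1, h2, h3, h4.of_map hinj, h5.of_map hinj⟩
    · apply map_injective _ hinj
      simp only [map_sum, map_mul, hg', hh', ← hF, smul_eq_C_mul, map_C, map_map,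
        ← IsScalarTower.algebraMap_eq]
      rfl
  refine ⟨fun k => φ ⟨c k, hcA k⟩, ?_, fun k hk => ?_, ?_⟩
  · rw [← map_one φ]
    exact congrArg φ (Subtype.ext hc)
  · rw [← map_zero φ]
    exact congrArg φ (Subtype.ext hk)
  · have := hA.map (φ : A →+* K)
    simp only [map_sum, map_mul, smul_eq_C_mul, map_C, map_map, AlgHom.comp_algebraMap] at this
    simpa [smul_eq_C_mul, MvPolynomial.map_id] using this

/-- If more than `k` forms vanish on an irreducible variety of codimension at most `k`, then some
homogeneous linear combination of them has bounded strength. -/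
lemma exists_linearCombination_strengthLE_of_mem_prime {K σ κ ι : Type*} [Field K] [IsAlgClosed K]
    [Finite σ] [Fintype κ] [Finite ι] (P : Ideal (MvPolynomial σ K)) [P.IsPrime]
    {f : κ → MvPolynomial σ K} {d : κ → ℕ} (hf : ∀ k, (f k).IsHomogeneous (d k))
    (hd : ∀ k, 0 < d k) (hfP : ∀ k, f k ∈ P) {u : ι → MvPolynomial σ K ⧸ P}
    (hu : AlgebraicIndependent K u) {k : ℕ} (hk : Nat.card σ ≤ Nat.card ι + k)
    (hκ : k < Fintype.card κ) :
    ∃ (k₀ : κ) (c : κ → K), c k₀ = 1 ∧ (∀ k, c k ≠ 0 → d k = d k₀) ∧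
      StrengthLE (d k₀) (k * (d k₀ - 1)) (∑ k, c k • f k) := by
  classical
  let A := MvPolynomial σ K ⧸ P
  let L := FractionRing A
  have : Algebra.EssFiniteType A L := .of_isLocalization L (nonZeroDivisors A)
  have : Algebra.EssFiniteType K L := .comp K A L
  let a : σ → L := fun i => algebraMap A L (Ideal.Quotient.mk P (X i))
  have haf (p : MvPolynomial σ K) : aeval a p = algebraMap A L (Ideal.Quotient.mk P p) := by
    have : aeval a = ((IsScalarTower.toAlgHom K A L).comp (Ideal.Quotient.mkₐ K P)) := by
      ext i
      simp only [a, aeval_X]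
      rfl
    rw [this]
    rfl
  have ha : IntermediateField.adjoin K (Set.range a) = ⊤ := by
    rw [eq_top_iff]
    intro x _
    have hA (y : A) : algebraMap A L y ∈ IntermediateField.adjoin K (Set.range a) := by
      obtain ⟨p, rfl⟩ := Ideal.Quotient.mk_surjective y
      rw [← haf]
      apply IntermediateField.algebra_adjoin_le_adjoin
      rw [Algebra.adjoin_range_eq_range_aeval]
      exact ⟨p, rfl⟩
    obtain ⟨y, z, hz, rfl⟩ := IsFractionRing.div_surjective (A := A) x
    exact div_mem (hA y) (hA z)
  let D := ∑ k, d k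
  obtain ⟨τ, ψ, hτ, hψ, hψτ, hψf⟩ := exists_truncated_lift a ha D
  have hcard : Nat.card ι ≤ Nat.card τ := by
    have h1 := (hu.map' (f := IsScalarTower.toAlgHom K A L)
      (IsFractionRing.injective A L)).lift_cardinalMk_le_trdeg
    have h2 := h1.trans (Cardinal.lift_le.2 hτ)
    have := Cardinal.toNat_le_toNat h2 (by simp)
    simpa [Nat.card] using this
  have hcompl : Nat.card ↥τᶜ ≤ k := by
    have := Nat.card_congr (Equiv.Set.sumCompl τ)
    rw [Nat.card_sum] at this
    omega
  obtain ⟨k₀, c, hc1, hc2, hc3⟩ := exists_linearCombination_strengthLE hψ hψτ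
    (f := fun k => MvPolynomial.map (algebraMap K L) (f k)) (fun k => (hf k).map _) hd (D := D)
    (fun k => Finset.single_le_sum (f := d) (fun _ _ => Nat.zero_le _) (Finset.mem_univ k))
    (fun k => by
      rw [aeval_map_algebraMap]
      refine hψf _ ?_
      rw [haf, Ideal.Quotient.eq_zero_iff_mem.2 (hfP k), map_zero])
    (hcompl.trans_lt hκ)
  obtain ⟨c', h1, h2, h3⟩ := exists_linearCombination_strengthLE_of_map k₀ c hc1 hc3
  exact ⟨k₀, c', h1, fun k hk => hc2 k fun h => hk (h2 k h),
    h3.mono (Nat.mul_le_mul_right _ hcompl)⟩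

/-- The ideal generated by the members `f i` with `i < j` of a finite sequence. -/
def initialIdeal {R : Type*} [CommRing R] {s : ℕ} (f : Fin s → R) (j : ℕ) : Ideal R :=
  Ideal.span (f '' {i | (i : ℕ) < j})

section

variable {K : Type*} {σ : Type u} [Field K] {s : ℕ} {f : Fin s → MvPolynomial σ K} {d : Fin s → ℕ}

lemma aeval_mem_initialIdeal {p : MvPolynomial (Fin s) K} {j : ℕ} (hp : p ∈ initialIdeal X j) :
    aeval f p ∈ initialIdeal f j := by
  refine Submodule.span_induction (p := fun p _ => aeval f p ∈ initialIdeal f j) ?_ (by simp)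
    (fun x y _ _ hx hy => ?_) (fun a x _ hx => ?_) hp
  · rintro _ ⟨i, hi, rfl⟩
    rw [aeval_X]
    exact Ideal.subset_span (Set.mem_image_of_mem f hi)
  · simpa using add_mem hx hy
  · simpa using Ideal.mul_mem_left _ _ hx

lemma sub_C_mem_initialIdeal (p : MvPolynomial (Fin s) K) :
    p - C (constantCoeff p) ∈ initialIdeal (X : Fin s → MvPolynomial (Fin s) K) s := by
  rw [initialIdeal, mem_ideal_span_X_image]
  intro m hm
  by_contra! h
  obtain rfl : m = 0 := Finsupp.ext fun i => by simpa using h i i.2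
  simp [constantCoeff_eq] at hm

lemma modMonomial_mem_initialIdeal {p : MvPolynomial (Fin s) K} {j : Fin s}
    (hp : p ∈ initialIdeal X (j + 1)) : p.modMonomial (Finsupp.single j 1) ∈
      initialIdeal (X : Fin s → MvPolynomial (Fin s) K) j := by
  rw [initialIdeal, mem_ideal_span_X_image] at *
  intro m hm
  have h1 : ¬ Finsupp.single j 1 ≤ m := by
    intro h
    rw [mem_support_iff, coeff_modMonomial_of_le _ h] at hm
    exact hm rfl
  rw [mem_support_iff, coeff_modMonomial_of_not_le _ h1, ← mem_support_iff] at hm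
  obtain ⟨i, hi, hi'⟩ := hp m hm
  refine ⟨i, ?_, hi'⟩
  simp only [Set.mem_ofPred_eq] at hi ⊢
  rcases (Nat.lt_succ_iff.1 hi).lt_or_eq with h | h
  · exact h
  · obtain rfl := Fin.ext h
    simp [Finsupp.single_le_iff] at h1
    exact absurd h1 hi'

/-- A homogeneous `K`-basis modulo a weakly regular sequence `f` of forms of positive degree
is a basis over the subalgebra generated by `f`, which is a polynomial ring. -/
lemma exists_basis_of_isWeaklyRegular (hf : ∀ i, (f i).IsHomogeneous (d i)) (hd : ∀ i, 0 < d i)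
    (hreg : ∀ (i : Fin s) (q : MvPolynomial σ K), f i * q ∈ initialIdeal f i →
      q ∈ initialIdeal f i) :
    ∃ (ι : Type u) (e : ι → MvPolynomial σ K),
      (∀ q, ∃ p : ι →₀ MvPolynomial (Fin s) K, p.sum (fun i a => aeval f a * e i) = q) ∧
      ∀ j ≤ s, ∀ p : ι →₀ MvPolynomial (Fin s) K,
        p.sum (fun i a => aeval f a * e i) ∈ initialIdeal f j → ∀ i, p i ∈ initialIdeal X j := by
  classical
  let S := MvPolynomial (Fin s) K
  let R := MvPolynomial σ K
  let : Algebra S R := (aeval f).toAlgebra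
  have : IsScalarTower K S R := .of_algebraMap_eq' (by
    ext; simp [RingHom.algebraMap_toAlgebra])
  have hsmul (p : S) (q : R) : p • q = aeval f p * q := rfl
  let I := initialIdeal f s
  let v : (σ →₀ ℕ) → R ⧸ I := fun m => Ideal.Quotient.mkₐ K I (monomial m 1)
  obtain ⟨ι, a, -, hspan, hli⟩ := exists_linearIndependent' K v
  let e : ι → R := fun i => monomial (a i) 1
  have htop : Submodule.span K (Set.range v) = ⊤ := by
    have h : LinearMap.range (Ideal.Quotient.mkₐ K I).toLinearMap = ⊤ :=
      LinearMap.range_eq_top.2 (Ideal.Quotient.mkₐ_surjective K I)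
    rw [← h, LinearMap.range_eq_map, ← (basisMonomials σ K).span_eq, Submodule.map_span,
      ← Set.range_comp]
    congr
  have hmem (q : R) : ∃ c : ι →₀ K, q - c.sum (fun i c => C c * e i) ∈ I := by
    have : Ideal.Quotient.mkₐ K I q ∈ Submodule.span K (Set.range (v ∘ a)) := by
      rw [hspan, htop]; trivial
    obtain ⟨c, hc⟩ := (Finsupp.mem_span_range_iff_exists_finsupp).1 this
    refine ⟨c, Ideal.Quotient.eq_zero_iff_mem.1 ?_⟩
    change Ideal.Quotient.mkₐ K I _ = 0
    rw [map_sub, ← hc, sub_eq_zero, Finsupp.sum, Finsupp.sum, map_sum]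
    refine Finset.sum_congr rfl fun i _ => ?_
    rw [← smul_eq_C_mul, map_smul]
    rfl
  refine ⟨ι, e, ?_, ?_⟩
  · suffices H : ∀ q : R, q ∈ Submodule.span S (Set.range e) by
      intro q
      obtain ⟨p, hp⟩ := (Finsupp.mem_span_range_iff_exists_finsupp).1 (H q)
      exact ⟨p, hp⟩
    have key : ∀ n (q : R), q.IsHomogeneous n → q ∈ Submodule.span S (Set.range e) := by
      intro n
      induction n using Nat.strong_induction_on with
      | _ n ih =>
      have hI : ∀ q ∈ I, homogeneousComponent n q ∈ Submodule.span S (Set.range e) := by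
        intro q hq
        obtain ⟨r, rfl⟩ : ∃ r : Fin s → R, q = ∑ i, r i * f i := by
          have : q ∈ Ideal.span (Set.range f) :=
            Ideal.span_mono (Set.image_subset_range _ _) hq
          obtain ⟨r, hr⟩ := Submodule.mem_span_range_iff_exists_fun _ |>.1 this
          exact ⟨r, hr.symm⟩
        rw [map_sum]
        refine sum_mem fun i _ => ?_
        rw [← sum_homogeneousComponent (r i), Finset.sum_mul, map_sum]
        refine sum_mem fun k _ => ?_
        rw [homogeneousComponent_of_mem
          ((homogeneousComponent_isHomogeneous k (r i)).mul (hf i))]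
        split_ifs with h
        · have := Submodule.smul_mem _ (X i : S) (ih k (by have := hd i; omega) _
            (homogeneousComponent_isHomogeneous k (r i)))
          rwa [hsmul, aeval_X, mul_comm] at this
        · simp
      intro q hq
      obtain ⟨c, hc⟩ := hmem q
      have := hI _ hc
      rw [map_sub, homogeneousComponent_of_mem hq, if_pos rfl] at this
      refine (Submodule.sub_mem_iff_left _ ?_).1 this
      rw [Finsupp.sum, map_sum]
      refine sum_mem fun i _ => ?_
      rw [homogeneousComponent_C_mul, homogeneousComponent_of_mem
        (isHomogeneous_monomial _ rfl : (e i).IsHomogeneous _)]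
      split_ifs
      · rw [← smul_eq_C_mul, ← algebraMap_smul S (c i) (e i)]
        exact Submodule.smul_mem _ _ (Submodule.subset_span ⟨i, rfl⟩)
      · simp
    intro q
    rw [← sum_homogeneousComponent q]
    exact sum_mem fun n _ => key n _ (homogeneousComponent_isHomogeneous _ _)
  · intro j hj
    induction hj using Nat.decreasingInduction with
    | self =>
      intro p hp i
      have h1 : p.sum (fun i a => C (constantCoeff a) * e i) ∈ I := by
        have h2 : p.sum (fun i a => aeval f (a - C (constantCoeff a)) * e i) ∈ I :=
          sum_mem fun i _ => Ideal.mul_mem_right _ _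
            (aeval_mem_initialIdeal (sub_C_mem_initialIdeal (p i)))
        convert sub_mem hp h2 using 1
        simp only [Finsupp.sum, ← Finset.sum_sub_distrib, ← sub_mul, ← map_sub, sub_sub_cancel]
        simp
      have h2 : ∑ i ∈ p.support, constantCoeff (p i) • (v ∘ a) i = 0 := by
        rw [← Ideal.Quotient.eq_zero_iff_mem] at h1
        change Ideal.Quotient.mkₐ K I _ = 0 at h1
        rw [← h1, Finsupp.sum, map_sum]
        refine Finset.sum_congr rfl fun i _ => ?_
        rw [← smul_eq_C_mul, map_smul]
        rfl
      have h3 : constantCoeff (p i) = 0 := by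
        by_cases hi : i ∈ p.support
        · exact linearIndependent_iff'.1 hli _ _ h2 i hi
        · rw [Finsupp.notMem_support_iff.1 hi, map_zero]
      simpa [h3] using sub_C_mem_initialIdeal (p i)
    | of_succ j hj ih =>
      intro p hp
      have hle : initialIdeal f j ≤ initialIdeal f (j + 1) :=
        Ideal.span_mono (Set.image_mono fun i hi => Nat.lt_succ_of_lt hi)
      have hD : ∃ D, ∀ i, p i ≠ 0 → (p i).totalDegree < D := by
        refine ⟨p.support.sup (fun i => (p i).totalDegree) + 1, fun i hi => ?_⟩
        exact Nat.lt_succ_of_le (Finset.le_sup (f := fun i => (p i).totalDegree) (by simpa))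
      obtain ⟨D, hD⟩ := hD
      induction D generalizing p with
      | zero =>
        intro i
        rw [not_imp_comm.1 (hD i) (by simp)]
        exact zero_mem _
      | succ D ihD =>
        have hp1 := ih p (hle hp)
        let j' : Fin s := ⟨j, hj⟩
        let δ := Finsupp.single j' 1
        let p' : ι →₀ S := p.mapRange (fun q => q.divMonomial δ) (by simp)
        let r : ι →₀ S := p - (X j' : S) • p'
        have hr (i) : r i ∈ initialIdeal (X : Fin s → S) j := by
          have := modMonomial_mem_initialIdeal (j := j') (hp1 i)
          rwa [← add_sub_cancel_left (X j' * (p i).divMonomial δ) ((p i).modMonomial _),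
            divMonomial_add_modMonomial_single] at this
        have h1 : Finsupp.linearCombination S e p' ∈ initialIdeal f j := by
          apply hreg j'
          have h2 : Finsupp.linearCombination S e r ∈ initialIdeal f j :=
            sum_mem fun i _ => Ideal.mul_mem_right _ _ (aeval_mem_initialIdeal (hr i))
          have h3 : f j' * Finsupp.linearCombination S e p' =
              Finsupp.linearCombination S e p - Finsupp.linearCombination S e r := by
            simp only [r, map_sub, map_smul, sub_sub_cancel, hsmul, aeval_X]
          rw [h3]
          exact sub_mem hp h2
        have h2 := ihD p' h1 fun i hi => by
          have hm : ∀ m ∈ (p' i).support, m.degree < D := by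
            intro m hm
            have h3 : δ + m ∈ (p i).support := by
              simpa [p', coeff_divMonomial] using hm
            have h4 := (le_totalDegree h3).trans_lt (hD i fun h => by simp [h] at h3)
            change (δ + m).degree < D + 1 at h4
            rw [map_add, Finsupp.degree_single] at h4
            omega
          obtain ⟨m, hm0⟩ := support_nonempty.2 hi
          exact (Finset.sup_lt_iff ((Nat.zero_le _).trans_lt (hm m hm0))).2 hm
        intro i
        have h3 : p i = X j' * p' i + r i := by simp [r]
        rw [h3]
        exact add_mem (Ideal.mul_mem_left _ _ (h2 i)) (hr i)

end

lemma isPrime_span_X_image {K σ : Type*} [CommRing K] [IsDomain K] (t : Set σ) :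
    (Ideal.span (X '' t : Set (MvPolynomial σ K))).IsPrime := by
  classical
  let θ : MvPolynomial σ K →ₐ[K] MvPolynomial σ K := aeval fun i => if i ∈ t then 0 else X i
  have hker : Ideal.span (X '' t : Set (MvPolynomial σ K)) = RingHom.ker θ := by
    refine le_antisymm (Ideal.span_le.2 ?_) fun p hp => ?_
    · rintro _ ⟨i, hi, rfl⟩
      simp [θ, hi]
    · have h : (Ideal.Quotient.mkₐ K (Ideal.span (X '' t))).comp θ =
          Ideal.Quotient.mkₐ K (Ideal.span (X '' t : Set (MvPolynomial σ K))) := by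
        ext i
        by_cases hi : i ∈ t
        · simpa [θ, hi] using
            (Ideal.Quotient.eq_zero_iff_mem.2 (Ideal.subset_span (Set.mem_image_of_mem X hi))).symm
        · simp [θ, hi]
      rw [← Ideal.Quotient.eq_zero_iff_mem]
      change Ideal.Quotient.mkₐ K _ p = 0
      rw [← h, AlgHom.comp_apply, (RingHom.mem_ker).1 hp, map_zero]
  rw [hker]
  exact RingHom.ker_isPrime _

section

variable {K σ : Type*} [Field K] {s : ℕ} {f : Fin s → MvPolynomial σ K} {d : Fin s → ℕ}

lemma flat_aeval_of_isWeaklyRegular (hf : ∀ i, (f i).IsHomogeneous (d i)) (hd : ∀ i, 0 < d i)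
    (hreg : ∀ (i : Fin s) (q : MvPolynomial σ K), f i * q ∈ initialIdeal f i →
      q ∈ initialIdeal f i) : (aeval (R := K) f).toRingHom.Flat := by
  obtain ⟨ι, e, he, hi⟩ := exists_basis_of_isWeaklyRegular hf hd hreg
  let : Algebra (MvPolynomial (Fin s) K) (MvPolynomial σ K) := (aeval f).toAlgebra
  have hli : LinearIndependent (MvPolynomial (Fin s) K) e := by
    rw [linearIndependent_iff]
    intro p hp
    ext1 i
    have := hi 0 (Nat.zero_le _) p (by
      change Finsupp.linearCombination _ e p ∈ _
      rw [hp]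
      exact zero_mem _) i
    simpa [initialIdeal] using this
  have hsp : ⊤ ≤ Submodule.span (MvPolynomial (Fin s) K) (Set.range e) := by
    intro q _
    obtain ⟨p, hp⟩ := he q
    exact (Finsupp.mem_span_range_iff_exists_finsupp).2 ⟨p, hp⟩
  have := Module.Free.of_basis (Module.Basis.mk hli hsp)
  exact (inferInstance : Module.Flat (MvPolynomial (Fin s) K) (MvPolynomial σ K))

lemma mem_initialIdeal_of_aeval_mul_mem (hf : ∀ i, (f i).IsHomogeneous (d i)) (hd : ∀ i, 0 < d i)
    (hreg : ∀ (i : Fin s) (q : MvPolynomial σ K), f i * q ∈ initialIdeal f i →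
      q ∈ initialIdeal f i) {j : ℕ} (hj : j ≤ s) {a : MvPolynomial (Fin s) K}
    (ha : a ∉ initialIdeal X j) {q : MvPolynomial σ K} (hq : aeval f a * q ∈ initialIdeal f j) :
    q ∈ initialIdeal f j := by
  obtain ⟨ι, e, he, hi⟩ := exists_basis_of_isWeaklyRegular hf hd hreg
  let : Algebra (MvPolynomial (Fin s) K) (MvPolynomial σ K) := (aeval f).toAlgebra
  have hP : (initialIdeal (X : Fin s → MvPolynomial (Fin s) K) j).IsPrime :=
    isPrime_span_X_image _
  obtain ⟨p, rfl⟩ := he q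
  refine sum_mem fun i _ => Ideal.mul_mem_right _ _ (aeval_mem_initialIdeal ?_)
  refine (hP.mem_or_mem (x := a) ?_).resolve_left ha
  refine hi j hj (a • p) ?_ i
  change Finsupp.linearCombination _ e (a • p) ∈ _
  rw [map_smul]
  exact hq

end

open CategoryTheory Abelian Limits Pointwise RingTheory.Sequence in
/-- If `Ext N M` vanishes below degree `c`, then modulo a weakly regular sequence on `M` of length
less than `c` there still is a regular element annihilating `N`. -/
lemma exists_isSMulRegular_of_subsingleton_ext {R : Type u} [CommRing R] [Small.{v} R]
    [IsNoetherianRing R] (N : ModuleCat.{v} R) [Module.Finite R N] (rs : List R)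
    (M : ModuleCat.{v} R) [Module.Finite R M] {c : ℕ} (h : ∀ i < c, Subsingleton (Ext N M i))
    (hrs : IsWeaklyRegular M rs) (hc : rs.length < c) :
    ∃ r ∈ Module.annihilator R N,
      IsSMulRegular (M ⧸ (Ideal.ofList rs • ⊤ : Submodule R M)) r := by
  induction rs generalizing M c with
  | nil =>
    have : Subsingleton (N ⟶ M) := Ext.addEquiv₀.subsingleton_congr.mp (h 0 hc)
    have : Subsingleton (N →ₗ[R] M) := ModuleCat.homAddEquiv.symm.subsingleton
    obtain ⟨r, hr, hr'⟩ := IsSMulRegular.subsingleton_linearMap_iff.mp this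
    exact ⟨r, hr, ((Submodule.quotEquivOfEqBot _ (by simp)).isSMulRegular_congr r).2 hr'⟩
  | cons x rs ih =>
    obtain ⟨hx, hrs⟩ := (isWeaklyRegular_cons_iff M x rs).1 hrs
    obtain ⟨c, rfl⟩ := Nat.exists_eq_add_of_lt ((Nat.zero_le _).trans_lt hc)
    obtain ⟨r, hr, hr'⟩ := ih (ModuleCat.of R (QuotSMulTop x M)) (c := c) (fun i hi => by
      have zero1 := AddCommGrpCat.isZero_of_iff_subsingleton.mpr (h i (by omega))
      have zero2 := AddCommGrpCat.isZero_of_iff_subsingleton.mpr (h (i + 1) (by omega))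
      exact AddCommGrpCat.subsingleton_of_isZero <| ShortComplex.Exact.isZero_of_both_zeros
        ((Ext.covariant_sequence_exact₃' N hx.smulShortComplex_shortExact) i (i + 1) rfl)
        (zero1.eq_zero_of_src _) (zero2.eq_zero_of_tgt _)) hrs (by simp at hc; omega)
    exact ⟨r, hr,
      ((Submodule.quotOfListConsSMulTopEquivQuotSMulTopInner M x rs).isSMulRegular_congr r).2 hr'⟩

section

open RingTheory.Sequence

lemma ofList_take_ofFn {R : Type*} [CommRing R] {s : ℕ} (f : Fin s → R) (j : ℕ) :
    Ideal.ofList ((List.ofFn f).take j) = initialIdeal f j := by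
  rw [Ideal.ofList, initialIdeal]
  congr 1
  ext r
  simp only [List.mem_take_iff_getElem, List.getElem_ofFn, List.length_ofFn, lt_min_iff]
  constructor
  · rintro ⟨i, hi, rfl⟩
    exact ⟨⟨i, hi.2⟩, hi.1, rfl⟩
  · rintro ⟨i, hi, rfl⟩
    exact ⟨i, ⟨hi, i.2⟩, rfl⟩

lemma ofList_ofFn {R : Type*} [CommRing R] {s : ℕ} (f : Fin s → R) :
    Ideal.ofList (List.ofFn f) = initialIdeal f s := by
  rw [← ofList_take_ofFn, List.take_of_length_le (by simp)]

lemma isWeaklyRegular_ofFn_iff {R : Type*} [CommRing R] {s : ℕ} {f : Fin s → R} :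
    IsWeaklyRegular R (List.ofFn f) ↔
      ∀ (i : Fin s) (q : R), f i * q ∈ initialIdeal f i → q ∈ initialIdeal f i := by
  rw [isWeaklyRegular_iff]
  simp only [List.length_ofFn, List.getElem_ofFn, ofList_take_ofFn, smul_eq_mul, Ideal.mul_top,
    isSMulRegular_quotient_iff_mem_of_smul_mem, Fin.forall_iff]

lemma isRegular_ofFn_X (K : Type*) [Field K] (N : ℕ) :
    IsRegular (MvPolynomial (Fin N) K) (List.ofFn (X : Fin N → MvPolynomial (Fin N) K)) := by
  rw [isRegular_iff]
  have hP (j : ℕ) : (initialIdeal (X : Fin N → MvPolynomial (Fin N) K) j).IsPrime :=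
    isPrime_span_X_image _
  refine ⟨isWeaklyRegular_ofFn_iff.2 fun i q h =>
    ((hP i).mem_or_mem h).resolve_left fun h => ?_, ?_⟩
  · rw [initialIdeal, mem_ideal_span_X_image] at h
    obtain ⟨j, hj, hj'⟩ := h (Finsupp.single i 1) (by simp [X])
    rw [Finsupp.single_apply] at hj'
    split_ifs at hj' with h
    · subst h
      simp at hj
    · exact hj' rfl
  · rw [ofList_ofFn, smul_eq_mul, Ideal.mul_top]
    exact (hP N).ne_top.symm

/-- Modulo a weakly regular sequence of fewer than `N` polynomials there is a linear form which is
not a zero divisor. -/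
lemma exists_linear_isSMulRegular {K : Type*} [Field K] [Infinite K] {N : ℕ}
    (l : List (MvPolynomial (Fin N) K)) (hl : IsWeaklyRegular (MvPolynomial (Fin N) K) l)
    (hlN : l.length < N) : ∃ p : MvPolynomial (Fin N) K, p.IsHomogeneous 1 ∧
      IsSMulRegular (MvPolynomial (Fin N) K ⧸
        (Ideal.ofList l • ⊤ : Submodule (MvPolynomial (Fin N) K) (MvPolynomial (Fin N) K))) p := by
  let R := MvPolynomial (Fin N) K
  let 𝔪 := initialIdeal (X : Fin N → MvPolynomial (Fin N) K) N
  have h𝔪 : 𝔪 • (⊤ : Submodule R R) < ⊤ := by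
    rw [smul_eq_mul, Ideal.mul_top, lt_top_iff_ne_top]
    exact (isPrime_span_X_image _).ne_top
  have hext := ModuleCat.subsingleton_ext_of_exists_isRegular 𝔪 (ModuleCat.of R (R ⧸ 𝔪))
    (by rw [Module.support_eq_zeroLocus, Ideal.annihilator_quotient]) (ModuleCat.of R R) h𝔪
    _ (by
      intro r hr
      change r ∈ initialIdeal X N
      rw [← ofList_ofFn]
      exact Ideal.subset_span hr) (isRegular_ofFn_X K N)
  rw [List.length_ofFn] at hext
  obtain ⟨r, hr, hr'⟩ := exists_isSMulRegular_of_subsingleton_ext _ l (ModuleCat.of R R) hext hl hlN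
  let M := R ⧸ (Ideal.ofList l • ⊤ : Submodule R R)
  change r ∈ Module.annihilator R (R ⧸ 𝔪) at hr
  change IsSMulRegular M r at hr'
  rw [Ideal.annihilator_quotient] at hr
  have hfin := associatedPrimes.finite R M
  let V := homogeneousSubmodule (Fin N) K 1
  let W : Ideal R → Subspace K V := fun P => (P.restrictScalars K).comap V.subtype
  have hW : ⊤ ∉ W '' associatedPrimes R M := by
    rintro ⟨P, hP, hPV⟩
    have hrP : r ∈ P := by
      refine Ideal.span_le.2 ?_ hr
      rintro _ ⟨i, -, rfl⟩
      have : (⟨X i, isHomogeneous_X K i⟩ : V) ∈ W P := hPV ▸ Submodule.mem_top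
      exact this
    have := Set.mem_biUnion hP hrP
    rw [biUnion_associatedPrimes_eq_compl_regular] at this
    exact this hr'
  have := Subspace.biUnion_ne_univ_of_top_notMem
    (s := (hfin.image W).toFinset) (by simpa using hW)
  obtain ⟨p, hp⟩ := (Set.ne_univ_iff_exists_notMem _).1 this
  refine ⟨p, p.2, ?_⟩
  by_contra h
  have h : (p : R) ∈ {r : R | IsSMulRegular M r}ᶜ := h
  rw [← biUnion_associatedPrimes_eq_compl_regular] at h
  obtain ⟨P, hP, hpP⟩ := Set.mem_iUnion₂.1 h
  exact hp (Set.mem_biUnion ((hfin.image W).mem_toFinset.2 (Set.mem_image_of_mem W hP)) hpP)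

end

section

open RingTheory.Sequence

section

variable {K : Type*} [Field K] {N : ℕ}

lemma exists_isWeaklyRegular_append [Infinite K] (n : ℕ) (l : List (MvPolynomial (Fin N) K))
    (hl : IsWeaklyRegular (MvPolynomial (Fin N) K) l)
    (hd : ∀ r ∈ l, ∃ d, 0 < d ∧ r.IsHomogeneous d) (hn : N ≤ l.length + n) :
    ∃ l', IsWeaklyRegular (MvPolynomial (Fin N) K) (l ++ l') ∧
      (∀ r ∈ l ++ l', ∃ d, 0 < d ∧ r.IsHomogeneous d) ∧ N ≤ (l ++ l').length := by
  induction n generalizing l with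
  | zero => exact ⟨[], by simpa using hl, by simpa using hd, by simpa using hn⟩
  | succ n ih =>
    by_cases h : N ≤ l.length
    · exact ⟨[], by simpa using hl, by simpa using hd, by simpa using h⟩
    obtain ⟨p, hp, hp'⟩ := exists_linear_isSMulRegular l hl (by omega)
    have h1 : IsWeaklyRegular (MvPolynomial (Fin N) K) (l ++ [p]) := by
      rw [isWeaklyRegular_append_iff]
      exact ⟨hl, (isWeaklyRegular_singleton_iff _ _).2 hp'⟩
    obtain ⟨l', h2, h3, h4⟩ := ih (l ++ [p]) h1 (by
      simp only [List.mem_append, List.mem_singleton]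
      rintro r (hr | rfl)
      exacts [hd r hr, ⟨1, one_pos, hp⟩]) (by simp; omega)
    exact ⟨p :: l', by simpa using h2, by simpa using h3, by simpa using h4⟩

lemma eq_zero_of_rename_mem_initialIdeal {a b s : ℕ} (h : ∀ i : Fin b, a + i < s)
    {p : MvPolynomial (Fin b) K}
    (hp : rename (fun i : Fin b => (⟨a + i, h i⟩ : Fin s)) p ∈ initialIdeal (X : Fin s → _) a) :
    p = 0 := by
  have hinj : Function.Injective (fun i : Fin b => (⟨a + i, h i⟩ : Fin s)) := by
    intro i j hij
    simpa [Fin.ext_iff] using hij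
  rw [← killCompl_rename_app (R := K) hinj p, ← RingHom.mem_ker]
  refine (Ideal.span_le.2 ?_ : initialIdeal X a ≤ RingHom.ker (killCompl (R := K) hinj)) hp
  rintro _ ⟨i, hi, rfl⟩
  simp only [SetLike.mem_coe, RingHom.mem_ker, killCompl, aeval_X]
  rw [dif_neg]
  rintro ⟨j, rfl⟩
  simp at hi

/-- A form which is a zero divisor modulo a weakly regular sequence `l` of forms lies, together with
`l`, in a prime ideal of height at most the length of `l`. -/
lemma exists_prime_of_not_isSMulRegular [Infinite K] (l : List (MvPolynomial (Fin N) K))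
    (hl : IsWeaklyRegular (MvPolynomial (Fin N) K) l)
    (hd : ∀ r ∈ l, ∃ d, 0 < d ∧ r.IsHomogeneous d) {g : MvPolynomial (Fin N) K}
    (hg : ¬ IsSMulRegular (MvPolynomial (Fin N) K ⧸
        (Ideal.ofList l • ⊤ : Submodule (MvPolynomial (Fin N) K) (MvPolynomial (Fin N) K))) g) :
    ∃ P : Ideal (MvPolynomial (Fin N) K), P.IsPrime ∧ (∀ r ∈ l, r ∈ P) ∧ g ∈ P ∧
      ∃ (n : ℕ) (u : Fin n → MvPolynomial (Fin N) K ⧸ P),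
        AlgebraicIndependent K u ∧ N ≤ n + l.length := by
  let R := MvPolynomial (Fin N) K
  obtain ⟨l', hl', hd', hN⟩ := exists_isWeaklyRegular_append N l hl hd (by simp)
  let M := R ⧸ (Ideal.ofList l • ⊤ : Submodule R R)
  have hg : g ∈ {r : R | IsSMulRegular M r}ᶜ := hg
  rw [← biUnion_associatedPrimes_eq_compl_regular] at hg
  obtain ⟨P, hPM, hgP⟩ := Set.mem_iUnion₂.1 hg
  obtain ⟨hP, x, hx⟩ := isAssociatedPrime_iff.1 hPM
  obtain ⟨q, rfl⟩ := Submodule.Quotient.mk_surjective _ x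
  have hq (r : R) : r ∈ P ↔ r * q ∈ Ideal.ofList l := by
    rw [hx, Submodule.mem_colon_singleton, Submodule.mem_bot, ← Submodule.Quotient.mk_smul,
      Submodule.Quotient.mk_eq_zero, smul_eq_mul, smul_eq_mul, Ideal.mul_top]
  have hq0 : q ∉ Ideal.ofList l := fun h =>
      hP.ne_top <| (Ideal.eq_top_iff_one _).2 <| (hq 1).2 <| by
    simpa using h
  choose d hd0 hdh using hd'
  let s := (l ++ l').length
  let f : Fin s → R := (l ++ l').get
  have hlf : List.ofFn f = l ++ l' := List.ofFn_get _
  rw [← hlf, isWeaklyRegular_ofFn_iff] at hl'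
  have hI : Ideal.ofList l = initialIdeal f l.length := by
    rw [← ofList_take_ofFn, hlf, List.take_left]
  have hτ (i : Fin l'.length) : l.length + i < s := by simp [s]
  refine ⟨P, hP, fun r hr => (hq r).2 (Ideal.mul_mem_right _ _ (Ideal.subset_span hr)), hgP,
    l'.length, fun i => Ideal.Quotient.mk P (f ⟨l.length + i, hτ i⟩), ?_, by
      rw [add_comm]; simpa using hN⟩
  rw [algebraicIndependent_iff]
  intro p hp
  have hp : aeval f (rename (fun i : Fin l'.length => (⟨l.length + i, hτ i⟩ : Fin s)) p) ∈ P := by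
    rw [← Ideal.Quotient.eq_zero_iff_mem, ← hp, aeval_rename]
    change Ideal.Quotient.mkₐ K P _ = _
    rw [← AlgHom.comp_apply, comp_aeval]
    rfl
  by_contra hp0
  refine hq0 ?_
  rw [hI]
  refine mem_initialIdeal_of_aeval_mul_mem (d := fun i => d _ (List.get_mem _ i))
    (fun i => hdh _ (List.get_mem _ i)) (fun i => hd0 _ (List.get_mem _ i)) hl' (by simp)
    (fun h => hp0 (eq_zero_of_rename_mem_initialIdeal hτ h)) ?_
  rw [← hI]
  exact (hq _).1 hp

end

end

section

open RingTheory.Sequence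

/-- The finite set `S` of forms is strong if no nontrivial homogeneous linear combination of its
members has strength bounded in terms of the cardinality of `S`. -/
def IsStrong {K σ : Type*} [Field K] (S : Finset (MvPolynomial σ K)) : Prop :=
  ∀ f₀ ∈ S, ∀ c : MvPolynomial σ K → K, c f₀ = 1 →
    (∀ f ∈ S, c f ≠ 0 → f.totalDegree = f₀.totalDegree) →
    ¬ StrengthLE f₀.totalDegree ((S.card - 1) * (f₀.totalDegree - 1)) (∑ f ∈ S, c f • f)

section

variable {K : Type*} [Field K] [IsAlgClosed K] {N : ℕ}

lemma IsStrong.isWeaklyRegular {S : Finset (MvPolynomial (Fin N) K)} (hS : IsStrong S)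
    (hdeg : ∀ f ∈ S, f.IsHomogeneous f.totalDegree ∧ 0 < f.totalDegree)
    (l : List (MvPolynomial (Fin N) K)) (hl : l.Nodup) (hlS : ∀ f ∈ l, f ∈ S) :
    IsWeaklyRegular (MvPolynomial (Fin N) K) l := by
  classical
  have : Infinite K := IsAlgClosed.instInfinite
  induction l using List.reverseRecOn with
  | nil => exact .nil _ _
  | append_singleton l g ih =>
    have hl1 : l.Nodup := hl.of_append_left
    have hlS1 : ∀ f ∈ l, f ∈ S := fun f hf => hlS f (List.mem_append_left _ hf)
    have hreg := ih hl1 hlS1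
    rw [isWeaklyRegular_append_iff, isWeaklyRegular_singleton_iff]
    refine ⟨hreg, ?_⟩
    by_contra hg
    obtain ⟨P, hP, hlP, hgP, n, u, hu, hn⟩ := exists_prime_of_not_isSMulRegular l hreg
      (fun r hr => ⟨_, (hdeg r (hlS1 r hr)).2, (hdeg r (hlS1 r hr)).1⟩) hg
    let T := (l ++ [g]).toFinset
    have hTS : T ⊆ S := fun f hf => hlS f (List.mem_toFinset.1 hf)
    have hTcard : T.card = l.length + 1 := by
      rw [List.toFinset_card_of_nodup hl]; simp
    obtain ⟨k₀, c, h1, h2, h3⟩ := exists_linearCombination_strengthLE_of_mem_prime (κ := T) P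
      (f := fun f => f) (d := fun f => f.1.totalDegree) (fun f => (hdeg f (hTS f.2)).1)
      (fun f => (hdeg f (hTS f.2)).2)
      (fun f => by
        have := List.mem_toFinset.1 f.2
        rw [List.mem_append, List.mem_singleton] at this
        rcases this with h | h
        · exact hlP _ h
        · rw [h]; exact hgP) hu (k := l.length) (by simpa using hn) (by simp [hTcard])
    have hcard := Finset.card_le_card hTS
    refine hS k₀ (hTS k₀.2) (fun f => if h : f ∈ T then c ⟨f, h⟩ else 0) (by simpa using h1) ?_ ?_
    · intro f _ hf
      by_cases h : f ∈ T
      · rw [dif_pos h] at hf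
        exact h2 ⟨f, h⟩ hf
      · exact absurd (dif_neg h) hf
    · have hsum : ∑ f ∈ S, (if h : f ∈ T then c ⟨f, h⟩ else 0) • f = ∑ k : T, c k • k.1 := by
        rw [← Finset.sum_subset hTS (fun f _ hf => by rw [dif_neg hf, zero_smul]),
          ← Finset.sum_coe_sort T]
        exact Finset.sum_congr rfl fun f _ => by rw [dif_pos f.2]
      rw [hsum]
      exact h3.mono (Nat.mul_le_mul_right _ (by omega))

end

end

section

variable {a : ℕ}

lemma knuth_one (a b : ℕ) : knuth a 1 b = a ^ b := by
  rw [knuth]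

lemma knuth_add_two_zero (a k : ℕ) : knuth a (k + 2) 0 = 1 := by
  rw [knuth]

lemma knuth_succ_one (a k : ℕ) : knuth a (k + 1) 1 = a := by
  cases k with
  | zero => simp [knuth_one]
  | succ k => rw [knuth]

lemma knuth_add_two_succ (a k b : ℕ) :
    knuth a (k + 2) (b + 1) = knuth a (k + 1) (knuth a (k + 2) b) := by
  cases b with
  | zero => rw [zero_add, knuth_succ_one, knuth_add_two_zero, knuth_succ_one]
  | succ b => rw [knuth]

lemma lt_knuth (ha : 2 ≤ a) (k b : ℕ) : b < knuth a (k + 1) b := by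
  induction k generalizing b with
  | zero =>
    rw [zero_add, knuth_one]
    exact Nat.lt_pow_self ha
  | succ k ih =>
    induction b with
    | zero => rw [knuth_add_two_zero]; exact one_pos
    | succ b ihb =>
      rw [knuth_add_two_succ]
      exact lt_of_le_of_lt ihb (ih _)

lemma knuth_strictMono (ha : 2 ≤ a) (k : ℕ) : StrictMono (knuth a (k + 1)) := by
  refine strictMono_nat_of_lt_succ fun b => ?_
  cases k with
  | zero =>
    rw [zero_add, knuth_one, knuth_one]
    exact Nat.pow_lt_pow_right ha (Nat.lt_succ_self b)
  | succ k =>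
    rw [knuth_add_two_succ]
    exact lt_knuth ha _ _

lemma knuth_le_knuth_succ (ha : 2 ≤ a) (k b : ℕ) : knuth a (k + 1) b ≤ knuth a (k + 2) b := by
  cases b with
  | zero =>
    rw [knuth_add_two_zero]
    cases k with
    | zero => simp [knuth_one]
    | succ k => rw [knuth_add_two_zero]
  | succ b =>
    rw [knuth_add_two_succ]
    exact (knuth_strictMono ha k).monotone (lt_knuth ha _ _)

lemma knuth_le_knuth_of_le (ha : 2 ≤ a) {k l : ℕ} (h : k ≤ l) (b : ℕ) :
    knuth a (k + 1) b ≤ knuth a (l + 1) b :=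
  monotone_nat_of_le_succ (f := fun k => knuth a (k + 1) b)
    (fun k => knuth_le_knuth_succ ha k b) h

lemma knuth_add (a k b n : ℕ) :
    knuth a (k + 2) (b + n) = (knuth a (k + 1))^[n] (knuth a (k + 2) b) := by
  induction n with
  | zero => rfl
  | succ n ih => rw [← add_assoc, knuth_add_two_succ, ih, Function.iterate_succ_apply']

lemma linear_le_knuth (ha : 3 ≤ a) {k b : ℕ} (hb : 2 ≤ b) :
    (2 * a - 2) * (b + 1) + 1 ≤ knuth a (k + 2) b := by
  refine le_trans ?_ (knuth_le_knuth_of_le (by omega) (Nat.succ_le_succ (Nat.zero_le k)) b)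
  obtain ⟨c, rfl⟩ : ∃ c, a = c + 3 := ⟨a - 3, by omega⟩
  rw [show 2 * (c + 3) - 2 = 2 * c + 4 by omega]
  induction b, hb using Nat.le_induction with
  | base =>
    rw [knuth_add_two_succ, knuth_succ_one, knuth_one]
    have : (c + 3) ^ 3 ≤ (c + 3) ^ (c + 3) := Nat.pow_le_pow_right (by omega) (by omega)
    refine le_trans ?_ this
    rw [show (c + 3) ^ 3 = c ^ 3 + 9 * c ^ 2 + 27 * c + 27 by ring]
    nlinarith [Nat.zero_le (c ^ 3), Nat.zero_le (c ^ 2)]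
  | succ b hb ih =>
    rw [knuth_add_two_succ, knuth_one]
    set x := knuth (c + 3) (0 + 2) b with hx
    change _ ≤ x at ih
    have h1 : 2 * x ≤ (c + 3) ^ x := by
      calc 2 * x ≤ (c + 3) * x := Nat.mul_le_mul_right _ (by omega)
        _ ≤ (c + 3) * (c + 3) ^ (x - 1) := by
          refine Nat.mul_le_mul_left _ ?_
          have := Nat.lt_pow_self (n := x - 1) (show 1 < c + 3 by omega)
          omega
        _ = (c + 3) ^ x := by
          rw [← pow_succ', Nat.sub_add_cancel (by omega)]
    nlinarith

/-- The bound for the number of forms obtained by making `r` forms of degree at most `j + 1`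
strong, when each replacement of a form multiplies the number of forms by at most `M`. -/
def strongBound (M : ℕ) : ℕ → ℕ → ℕ
  | 0, r => r
  | j + 1, r => (fun x => strongBound M j (M * x))^[r] (strongBound M j r)

lemma le_iterate_of_id_le {f : ℕ → ℕ} (hf : ∀ x, x ≤ f x) (n x : ℕ) : x ≤ f^[n] x :=
  Function.id_le_iterate_of_id_le hf n x

lemma le_strongBound {M : ℕ} (hM : 1 ≤ M) (j r : ℕ) : r ≤ strongBound M j r := by
  induction j generalizing r with
  | zero => exact le_rfl
  | succ j ih =>
    exact (ih r).trans (le_iterate_of_id_le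
      (fun x => (Nat.le_mul_of_pos_left x hM).trans (ih _)) _ _)

lemma strongBound_mono {M : ℕ} (hM : 1 ≤ M) (j : ℕ) : Monotone (strongBound M j) := by
  induction j with
  | zero => exact monotone_id
  | succ j ih =>
    intro r s h
    have hmono : Monotone fun x => strongBound M j (M * x) :=
      fun x y hxy => ih (Nat.mul_le_mul_left _ hxy)
    refine (hmono.iterate r (ih h)).trans ?_
    refine Function.monotone_iterate_of_id_le (fun x => ?_) h _
    exact (Nat.le_mul_of_pos_left x hM).trans (le_strongBound hM _ _)

lemma strongBound_zero (M j : ℕ) : strongBound M j 0 = 0 := by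
  induction j with
  | zero => rfl
  | succ j ih => exact ih

lemma strongBound_lt_knuth (ha : 3 ≤ a) (j : ℕ) {r : ℕ} (hr : 3 ≤ r) :
    strongBound (2 * a - 3) j ((2 * a - 3) * r) < knuth a (2 * j + 2) r := by
  set M := 2 * a - 3 with hM
  have hM1 : 1 ≤ M := by omega
  have hMa : 2 * a - 2 = M + 1 := by omega
  induction j generalizing r with
  | zero =>
    have := linear_le_knuth ha (k := 0) (b := r) (by omega)
    rw [hMa] at this
    simp only [strongBound, mul_zero]
    nlinarith
  | succ j ih =>
    set S : ℕ → ℕ := fun x => strongBound M j (M * x) with hS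
    set T := knuth a (2 * j + 2) with hT
    have hTm : Monotone T := (knuth_strictMono (by omega) (2 * j + 1)).monotone
    have hSle (x : ℕ) : x ≤ S x := (Nat.le_mul_of_pos_left x hM1).trans (le_strongBound hM1 _ _)
    have key (n : ℕ) : S^[n + 1] r < T^[n + 1] r := by
      induction n with
      | zero => exact ih hr
      | succ n ihn =>
        rw [Function.iterate_succ_apply', Function.iterate_succ_apply' T]
        exact (ih (hr.trans (le_iterate_of_id_le hSle _ _))).trans_le (hTm ihn.le)
    have h1 : strongBound M (j + 1) (M * r) = S^[M * r + 1] r := rfl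
    rw [h1]
    refine (key _).trans_le ?_
    have h2 : T^[M * r + 1] r ≤ T^[M * r + 1] (knuth a (2 * j + 3) r) :=
      hTm.iterate _ (lt_knuth (by omega) (2 * j + 2) r).le
    refine h2.trans ?_
    rw [← knuth_add a (2 * j + 1)]
    obtain ⟨b, rfl⟩ : ∃ b, r = b + 1 := ⟨r - 1, by omega⟩
    rw [show 2 * (j + 1) + 2 = 2 * j + 2 + 2 by ring, knuth_add_two_succ]
    refine (knuth_strictMono (by omega) (2 * j + 2)).monotone ?_
    have := linear_le_knuth ha (k := 2 * j + 2) (b := b) (by omega)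
    rw [hMa] at this
    nlinarith

end

section

variable {K σ : Type*} [Field K]

/-- `S` consists of forms of positive degree at most `d`. -/
def IsFormFamily (d : ℕ) (S : Finset (MvPolynomial σ K)) : Prop :=
  ∀ f ∈ S, f.IsHomogeneous f.totalDegree ∧ 0 < f.totalDegree ∧ f.totalDegree ≤ d

/-- The condition of `IsStrong` restricted to the forms of degree at most `j`. -/
def IsStrongUpTo (j : ℕ) (S : Finset (MvPolynomial σ K)) : Prop :=
  ∀ f₀ ∈ S, f₀.totalDegree ≤ j → ∀ c : MvPolynomial σ K → K, c f₀ = 1 →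
    (∀ f ∈ S, c f ≠ 0 → f.totalDegree = f₀.totalDegree) →
    ¬ StrengthLE f₀.totalDegree ((S.card - 1) * (f₀.totalDegree - 1)) (∑ f ∈ S, c f • f)

/-- The number of elements of `S` of total degree `j`. -/
def degreeCount (j : ℕ) (S : Finset (MvPolynomial σ K)) : ℕ :=
  (S.filter fun f => f.totalDegree = j).card

lemma IsFormFamily.exists_replace {d : ℕ} {S : Finset (MvPolynomial σ K)}
    (hS : IsFormFamily d S) {f₀ : MvPolynomial σ K} (hf₀ : f₀ ∈ S) {c : MvPolynomial σ K → K}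
    (hc : c f₀ = 1)
    (hstr : StrengthLE f₀.totalDegree ((S.card - 1) * (f₀.totalDegree - 1))
      (∑ f ∈ S, c f • f)) :
    ∃ S' : Finset (MvPolynomial σ K), IsFormFamily d S' ∧
      Algebra.adjoin K (S : Set (MvPolynomial σ K)) ≤ Algebra.adjoin K S' ∧
      S'.card + 1 ≤ S.card + 2 * ((S.card - 1) * (f₀.totalDegree - 1)) ∧
      (∀ j, f₀.totalDegree < j → degreeCount j S' ≤ degreeCount j S) ∧
      degreeCount f₀.totalDegree S' < degreeCount f₀.totalDegree S := by
  classical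
  obtain ⟨n, hn, g, h, a, b, hgh, hsum⟩ := hstr
  set T := Finset.univ.image g ∪ Finset.univ.image h with hT
  have hTcard : T.card ≤ 2 * n := by
    refine (Finset.card_union_le _ _).trans ?_
    have h1 := Finset.card_image_le (s := (Finset.univ : Finset (Fin n))) (f := g)
    have h2 := Finset.card_image_le (s := (Finset.univ : Finset (Fin n))) (f := h)
    simp only [Finset.card_univ, Fintype.card_fin] at h1 h2
    omega
  have hTdeg : ∀ f ∈ T, f ≠ 0 → f.IsHomogeneous f.totalDegree ∧ 0 < f.totalDegree ∧
      f.totalDegree < f₀.totalDegree := by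
    intro f hf hf0
    simp only [hT, Finset.mem_union, Finset.mem_image, Finset.mem_univ, true_and] at hf
    rcases hf with ⟨i, rfl⟩ | ⟨i, rfl⟩ <;> obtain ⟨ha, hb, hab, hg, hh⟩ := hgh i
    · rw [hg.totalDegree hf0]
      exact ⟨hg, ha, by omega⟩
    · rw [hh.totalDegree hf0]
      exact ⟨hh, hb, by omega⟩
  have hfilter (j : ℕ) (hj : f₀.totalDegree ≤ j) :
      ((S.erase f₀ ∪ T).erase 0).filter (fun f => f.totalDegree = j) ⊆
        (S.filter fun f => f.totalDegree = j).erase f₀ := by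
    intro f hf
    simp only [Finset.mem_filter, Finset.mem_erase, Finset.mem_union] at hf ⊢
    obtain ⟨⟨hf0, hf1 | hf1⟩, hfj⟩ := hf
    · exact ⟨hf1.1, hf1.2, hfj⟩
    · have := (hTdeg f hf1 hf0).2.2
      omega
  refine ⟨(S.erase f₀ ∪ T).erase 0, ?_, ?_, ?_, ?_, ?_⟩
  · intro f hf
    simp only [Finset.mem_erase, Finset.mem_union] at hf
    obtain ⟨hf0, hf1 | hf1⟩ := hf
    · exact hS f hf1.2
    · obtain ⟨h1, h2, h3⟩ := hTdeg f hf1 hf0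
      exact ⟨h1, h2, h3.le.trans (hS f₀ hf₀).2.2⟩
  · set B := Algebra.adjoin K ((((S.erase f₀ ∪ T).erase 0 : Finset _)) : Set (MvPolynomial σ K))
    have hmem : ∀ f ∈ S.erase f₀ ∪ T, f ∈ B := by
      intro f hf
      by_cases hf0 : f = 0
      · rw [hf0]
        exact B.zero_mem
      · exact Algebra.subset_adjoin (Finset.mem_erase.mpr ⟨hf0, hf⟩)
    refine Algebra.adjoin_le fun f hf => ?_
    by_cases hff : f = f₀
    · rw [hff]
      rw [← Finset.add_sum_erase _ _ hf₀, hc, one_smul] at hsum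
      rw [eq_sub_of_add_eq hsum]
      refine B.sub_mem (B.sum_mem fun i _ => B.mul_mem (hmem _ ?_) (hmem _ ?_))
        (B.sum_mem fun i hi => B.smul_mem (hmem _ (Finset.mem_union_left _ hi)) _)
      · simp [hT]
      · simp [hT]
    · exact hmem f (Finset.mem_union_left _ (Finset.mem_erase.mpr ⟨hff, hf⟩))
  · have h1 := Finset.card_erase_le (s := S.erase f₀ ∪ T) (a := 0)
    have h2 := Finset.card_union_le (S.erase f₀) T
    have h3 := Finset.card_erase_add_one hf₀
    omega
  · intro j hj
    exact (Finset.card_le_card (hfilter j hj.le)).trans (Finset.card_erase_le)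
  · refine (Finset.card_le_card (hfilter _ le_rfl)).trans_lt
      (Finset.card_erase_lt_of_mem ?_)
    simp [hf₀]

lemma IsFormFamily.exists_isStrongUpTo {d : ℕ} (j : ℕ) {S : Finset (MvPolynomial σ K)}
    (hS : IsFormFamily d S) (hd : 1 ≤ d) :
    ∃ S' : Finset (MvPolynomial σ K), IsFormFamily d S' ∧
      Algebra.adjoin K (S : Set (MvPolynomial σ K)) ≤ Algebra.adjoin K S' ∧
      IsStrongUpTo (j + 1) S' ∧ S'.card ≤ strongBound (2 * d - 1) j S.card ∧
      ∀ i, j + 1 < i → degreeCount i S' ≤ degreeCount i S := by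
  have hM : 1 ≤ 2 * d - 1 := by omega
  induction j generalizing S with
  | zero =>
    induction hk : S.card using Nat.strong_induction_on generalizing S with
    | _ k ih =>
      by_cases hstrong : IsStrongUpTo 1 S
      · exact ⟨S, hS, le_rfl, hstrong, hk.le, fun i _ => le_rfl⟩
      simp only [IsStrongUpTo, not_forall, not_not] at hstrong
      obtain ⟨f₀, hf₀, hdeg, c, hc, -, hstr⟩ := hstrong
      obtain ⟨S₁, hS₁, hadj, hcard, hcount, -⟩ := hS.exists_replace hf₀ hc hstr
      have hdeg' : f₀.totalDegree = 1 := by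
        have := (hS f₀ hf₀).2.1
        omega
      simp only [hdeg', Nat.sub_self, mul_zero, add_zero] at hcard hcount
      obtain ⟨S₂, hS₂, hadj₂, hstr₂, hcard₂, hcount₂⟩ := ih S₁.card (by omega) hS₁ rfl
      refine ⟨S₂, hS₂, hadj.trans hadj₂, hstr₂, ?_, fun i hi =>
        (hcount₂ i hi).trans (hcount i (by omega))⟩
      simp only [strongBound] at hcard₂ ⊢
      omega
  | succ j ih =>
    set G : ℕ → ℕ := fun x => strongBound (2 * d - 1) j ((2 * d - 1) * x) with hG
    have hGle (x : ℕ) : x ≤ G x :=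
      (Nat.le_mul_of_pos_left x hM).trans (le_strongBound hM _ _)
    have hGmono : Monotone G := fun x y hxy =>
      strongBound_mono hM j (Nat.mul_le_mul_left _ hxy)
    suffices H : ∀ (n : ℕ) (S : Finset (MvPolynomial σ K)), IsFormFamily d S →
        degreeCount (j + 2) S ≤ n → ∃ S' : Finset (MvPolynomial σ K), IsFormFamily d S' ∧
          Algebra.adjoin K (S : Set (MvPolynomial σ K)) ≤ Algebra.adjoin K S' ∧
          IsStrongUpTo (j + 2) S' ∧ S'.card ≤ G^[n] (strongBound (2 * d - 1) j S.card) ∧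
          ∀ i, j + 2 < i → degreeCount i S' ≤ degreeCount i S from
      H S.card S hS (Finset.card_filter_le _ _)
    intro n
    induction n with
    | zero =>
      intro S hS hn
      obtain ⟨S₁, hS₁, hadj, hstr, hcard, hcount⟩ := ih hS
      refine ⟨S₁, hS₁, hadj, ?_, hcard, fun i hi => hcount i (by omega)⟩
      intro f₀ hf₀ hdeg
      refine hstr f₀ hf₀ (Nat.le_of_lt_succ (lt_of_le_of_ne hdeg fun he => ?_))
      have h1 := (hcount (j + 2) (by omega)).trans hn
      have : f₀ ∈ S₁.filter fun f => f.totalDegree = j + 2 := by simp [hf₀, he]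
      rw [Finset.card_eq_zero.mp (Nat.le_zero.mp h1)] at this
      simp at this
    | succ n ihn =>
      intro S hS hn
      obtain ⟨S₁, hS₁, hadj, hstr, hcard, hcount⟩ := ih hS
      by_cases hstrong : IsStrongUpTo (j + 2) S₁
      · exact ⟨S₁, hS₁, hadj, hstrong, hcard.trans (le_iterate_of_id_le hGle _ _),
          fun i hi => hcount i (by omega)⟩
      simp only [IsStrongUpTo, not_forall, not_not] at hstrong
      obtain ⟨f₀, hf₀, hdeg, c, hc, hcdeg, hstr₀⟩ := hstrong
      have hdeg' : f₀.totalDegree = j + 2 := by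
        by_contra hne
        exact hstr f₀ hf₀ (by omega) c hc hcdeg hstr₀
      obtain ⟨S₂, hS₂, hadj₂, hcard₂, hcount₂, hcount₂'⟩ := hS₁.exists_replace hf₀ hc hstr₀
      rw [hdeg'] at hcard₂ hcount₂ hcount₂'
      obtain ⟨S₃, hS₃, hadj₃, hstr₃, hcard₃, hcount₃⟩ := ihn S₂ hS₂
        (by have := hcount (j + 2) (by omega); omega)
      refine ⟨S₃, hS₃, hadj.trans (hadj₂.trans hadj₃), hstr₃, ?_, fun i hi =>
        (hcount₃ i hi).trans ((hcount₂ i hi).trans (hcount i (by omega)))⟩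
      have hle : S₂.card ≤ (2 * d - 1) * S₁.card := by
        have hjd : j + 2 ≤ d := hdeg' ▸ (hS₁ f₀ hf₀).2.2
        obtain ⟨t, ht⟩ : ∃ t, S₁.card = t + 1 :=
          ⟨S₁.card - 1, (Nat.sub_add_cancel (Finset.card_pos.mpr ⟨f₀, hf₀⟩)).symm⟩
        obtain ⟨u, rfl⟩ : ∃ u, d = j + 2 + u := ⟨d - (j + 2), by omega⟩
        rw [ht] at hcard₂ ⊢
        rw [show 2 * (j + 2 + u) - 1 = 2 * j + 3 + 2 * u by omega]
        simp only [Nat.add_sub_cancel, show j + 2 - 1 = j + 1 by omega] at hcard₂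
        nlinarith [Nat.zero_le (u * t), Nat.zero_le u]
      calc S₃.card ≤ G^[n] (strongBound (2 * d - 1) j S₂.card) := hcard₃
        _ ≤ G^[n] (G S₁.card) := hGmono.iterate n (strongBound_mono hM j hle)
        _ ≤ G^[n] (G (strongBound (2 * d - 1) j S.card)) := hGmono.iterate n (hGmono hcard)

end

lemma strongBound_le_knuth {d r : ℕ} (hd : 2 ≤ d) :
    strongBound (2 * d - 1) (d - 1) (r * d) ≤ knuth (d + 1) (d ^ 2 + d - 2) ((d + 1) ^ r) := by
  rcases Nat.eq_zero_or_pos r with rfl | hr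
  · rw [zero_mul, strongBound_zero]
    exact Nat.zero_le _
  have hsq : d * 2 ≤ d ^ 2 := by
    rw [sq]
    exact Nat.mul_le_mul_left d hd
  have hpow : max 3 r ≤ (d + 1) ^ r :=
    max_le ((by omega : 3 ≤ d + 1).trans (Nat.le_self_pow hr.ne' _))
      (Nat.lt_pow_self (by omega)).le
  have hle : r * d ≤ (2 * d - 1) * max 3 r := by
    rw [mul_comm]
    exact Nat.mul_le_mul (by omega) (le_max_right _ _)
  have h1 := strongBound_lt_knuth (a := d + 1) (by omega) (d - 1) (le_max_left 3 r)
  rw [show 2 * (d + 1) - 3 = 2 * d - 1 by omega,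
    show 2 * (d - 1) + 2 = 2 * d - 1 + 1 by omega] at h1
  rw [show d ^ 2 + d - 2 = d ^ 2 + d - 3 + 1 by omega]
  exact (strongBound_mono (by omega) _ hle).trans (h1.le.trans
    (((knuth_strictMono (by omega) _).monotone hpow).trans
      (knuth_le_knuth_of_le (by omega) (by omega) _)))

lemma exists_flat_aeval {K : Type*} [Field K] [IsAlgClosed K] {N : ℕ} {d : ℕ} (hd : 2 ≤ d)
    {ι : Type*} [Fintype ι] (A : ι → MvPolynomial (Fin N) K)
    (hA : ∀ i, (A i).totalDegree ≤ d) :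
    ∃ (s : ℕ) (f : Fin s → MvPolynomial (Fin N) K),
      s ≤ knuth (d + 1) (d ^ 2 + d - 2) ((d + 1) ^ Fintype.card ι) ∧
      (aeval (R := K) f).toRingHom.Flat ∧ ∀ i, A i ∈ (aeval (R := K) f).range := by
  classical
  set S₀ : Finset (MvPolynomial (Fin N) K) :=
    ((Finset.univ : Finset (ι × Fin d)).image fun p =>
      homogeneousComponent (p.2 + 1) (A p.1)).erase 0 with hS₀
  have hform : IsFormFamily d S₀ := by
    intro f hf
    simp only [hS₀, Finset.mem_erase, Finset.mem_image, Finset.mem_univ, true_and] at hf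
    obtain ⟨hf0, p, rfl⟩ := hf
    have hhom := homogeneousComponent_isHomogeneous (p.2 + 1 : ℕ) (A p.1)
    rw [hhom.totalDegree hf0]
    exact ⟨hhom, Nat.succ_pos _, p.2.2⟩
  have hcard : S₀.card ≤ Fintype.card ι * d := by
    refine Finset.card_erase_le.trans (Finset.card_image_le.trans ?_)
    simp
  obtain ⟨S, hS, hadj, hstrong, hScard, -⟩ := hform.exists_isStrongUpTo (d - 1) (by omega)
  rw [Nat.sub_add_cancel (by omega : 1 ≤ d)] at hstrong
  have hstrong' : IsStrong S := fun f₀ hf₀ => hstrong f₀ hf₀ (hS f₀ hf₀).2.2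
  have hmem (i : Fin S.toList.length) : S.toList.get i ∈ S :=
    Finset.mem_toList.mp (S.toList.get_mem i)
  have hreg := hstrong'.isWeaklyRegular (fun f hf => ⟨(hS f hf).1, (hS f hf).2.1⟩) S.toList
    S.nodup_toList (fun f hf => Finset.mem_toList.mp hf)
  rw [← List.ofFn_get S.toList, isWeaklyRegular_ofFn_iff] at hreg
  refine ⟨S.toList.length, S.toList.get, ?_,
    flat_aeval_of_isWeaklyRegular (fun i => (hS _ (hmem i)).1) (fun i => (hS _ (hmem i)).2.1)
      hreg, fun i => ?_⟩
  · rw [Finset.length_toList]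
    exact hScard.trans ((strongBound_mono (by omega) _ hcard).trans (strongBound_le_knuth hd))
  · rw [← Algebra.adjoin_range_eq_range_aeval]
    have hrange : Set.range S.toList.get = S := by
      ext f
      simp
    rw [hrange]
    refine hadj ?_
    rw [← sum_homogeneousComponent (A i)]
    refine Subalgebra.sum_mem _ fun k hk => ?_
    rcases k with _ | k
    · rw [homogeneousComponent_zero]
      exact Subalgebra.algebraMap_mem _ _
    · by_cases h0 : homogeneousComponent (k + 1) (A i) = 0
      · rw [h0]
        exact Subalgebra.zero_mem _
      · refine Algebra.subset_adjoin (Finset.mem_erase.mpr ⟨h0, Finset.mem_image.mpr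
          ⟨(i, ⟨k, ?_⟩), Finset.mem_univ _, rfl⟩⟩)
        have := hA i
        rw [Finset.mem_range] at hk
        omega

section

open CategoryTheory Limits

variable {C : Type*} [Category C] [Abelian C]

/-- The augmented chain complex `X → Z` is a projective resolution of length at most `n`. -/
structure IsProjectiveResolutionLE {Z : C} (X : ChainComplex C ℕ) (ε : X.X 0 ⟶ Z) (n : ℕ) :
    Prop where
  projective (i : ℕ) : Projective (X.X i)
  isZero (i : ℕ) (hi : n < i) : IsZero (X.X i)
  zero : X.d 1 0 ≫ ε = 0
  exact_zero : (ShortComplex.mk _ _ zero).Exact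
  exact_succ (i : ℕ) : (ShortComplex.mk _ _ (X.d_comp_d (i + 2) (i + 1) i)).Exact
  epi : Epi ε

lemma IsProjectiveResolutionLE.augment {S : ShortComplex C} (hS : S.ShortExact)
    [Projective S.X₂] {X : ChainComplex C ℕ} {ε : X.X 0 ⟶ S.X₁} {n : ℕ}
    (h : IsProjectiveResolutionLE X ε n) :
    ∃ (X' : ChainComplex C ℕ) (ε' : X'.X 0 ⟶ S.X₃), IsProjectiveResolutionLE X' ε' (n + 1) := by
  have w : X.d 1 0 ≫ ε ≫ S.f = 0 := by rw [← Category.assoc, h.zero, zero_comp]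
  have w' : (ε ≫ S.f) ≫ S.g = 0 := by rw [Category.assoc, S.zero, comp_zero]
  have := h.epi
  have := hS.mono_f
  refine ⟨X.augment (X := S.X₂) (ε ≫ S.f) w, S.g, ?_, ?_, w', ?_, ?_, hS.epi_g⟩
  · rintro (_ | i)
    · assumption
    · exact h.projective i
  · rintro (_ | i) hi
    · omega
    · exact h.isZero i (by omega)
  · let φ : ShortComplex.mk _ _ w' ⟶ S := { τ₁ := ε, τ₂ := 𝟙 _, τ₃ := 𝟙 _ }
    exact (ShortComplex.exact_iff_of_epi_of_isIso_of_mono φ).2 hS.exact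
  · rintro (_ | i)
    · let φ : ShortComplex.mk _ _ h.zero ⟶ ShortComplex.mk _ _ w :=
        { τ₁ := 𝟙 _, τ₂ := 𝟙 _, τ₃ := S.f }
      exact (ShortComplex.exact_iff_of_epi_of_isIso_of_mono φ).1 h.exact_zero
    · exact h.exact_succ i

lemma exists_isProjectiveResolutionLE [EnoughProjectives C] (n : ℕ) (Z : C)
    [hZ : HasProjectiveDimensionLE Z n] :
    ∃ (X : ChainComplex C ℕ) (ε : X.X 0 ⟶ Z), IsProjectiveResolutionLE X ε n := by
  induction n generalizing Z with
  | zero =>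
    have := (projective_iff_hasProjectiveDimensionLE_zero (X := Z)).2 hZ
    have hzero (i : ℕ) (hi : 0 < i) : IsZero (((ChainComplex.single₀ C).obj Z).X i) :=
      HomologicalComplex.isZero_single_obj_X _ _ _ _ hi.ne'
    refine ⟨(ChainComplex.single₀ C).obj Z, 𝟙 Z, ?_, hzero, ?_, ?_, ?_, ?_⟩
    · rintro (_ | i)
      · exact this
      · exact (hzero _ i.succ_pos).projective
    · exact (hzero 1 one_pos).eq_of_src _ _
    · exact (ShortComplex.exact_iff_mono _ ((hzero 1 one_pos).eq_of_src _ _)).2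
        (inferInstanceAs (Mono (𝟙 Z)))
    · exact fun i => ShortComplex.exact_of_isZero_X₂ _ (hzero _ i.succ_pos)
    · exact inferInstanceAs (Epi (𝟙 Z))
  | succ n ih =>
    let S : ShortComplex C := ShortComplex.mk _ _ (kernel.condition (Projective.π Z))
    have hS : S.ShortExact :=
      { exact := ShortComplex.exact_of_f_is_kernel _ (kernelIsKernel _)
        mono_f := inferInstanceAs (Mono (kernel.ι _))
        epi_g := inferInstanceAs (Epi (Projective.π Z)) }
    have hp : Projective S.X₂ := inferInstanceAs (Projective (Projective.over Z))
    have : HasProjectiveDimensionLE S.X₁ n := (hS.hasProjectiveDimensionLT_X₃_iff n hp).1 hZ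
    obtain ⟨X, ε, h⟩ := ih S.X₁
    exact h.augment hS

lemma IsProjectiveResolutionLE.exists_projectiveResolution {Z : C} {X : ChainComplex C ℕ}
    {ε : X.X 0 ⟶ Z} {n : ℕ} (h : IsProjectiveResolutionLE X ε n) :
    ∃ P : ProjectiveResolution Z, ∀ i, n < i → IsZero (P.complex.X i) := by
  refine ⟨{
    complex := X
    projective := h.projective
    π := (ChainComplex.toSingle₀Equiv _ _).symm ⟨ε, h.zero⟩
    quasiIso := ⟨fun i => ?_⟩ }, h.isZero⟩
  cases i with
  | zero =>
    rw [ChainComplex.quasiIsoAt₀_iff, ShortComplex.quasiIso_iff_of_zeros']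
    · have := h.epi
      refine (ShortComplex.exact_and_epi_g_iff_of_iso ?_).2 ⟨h.exact_zero, h.epi⟩
      exact ShortComplex.isoMk (Iso.refl _) (Iso.refl _) (Iso.refl _)
        ((Category.id_comp _).trans (Category.comp_id _).symm)
        ((Category.id_comp _).trans ((Category.comp_id _).trans
          (ChainComplex.toSingle₀Equiv_symm_apply_f_zero ε h.zero)).symm)
    · exact X.shape _ _ (by simp)
    all_goals rfl
  | succ i =>
    rw [quasiIsoAt_iff_exactAt' _ _ (ChainComplex.exactAt_succ_single_obj _ _),
      HomologicalComplex.exactAt_iff' _ (i + 2) (i + 1) i (by simp) (by simp)]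
    exact h.exact_succ i

lemma projDimLE_of_hasProjectiveDimensionLE {R M : Type u} [CommRing R] [AddCommGroup M]
    [Module R M] (n : ℕ) [HasProjectiveDimensionLE (ModuleCat.of R M) n] : ProjDimLE R M n := by
  obtain ⟨X, ε, h⟩ := exists_isProjectiveResolutionLE n (ModuleCat.of R M)
  exact h.exists_projectiveResolution

end

section

open CategoryTheory TensorProduct

lemma LinearMap.shortExact_of_exact {R M N L : Type u} [CommRing R] [AddCommGroup M] [Module R M]
    [AddCommGroup N] [Module R N] [AddCommGroup L] [Module R L] {f : M →ₗ[R] N} {g : N →ₗ[R] L}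
    (hf : Function.Injective f) (hfg : Function.Exact f g) (hg : Function.Surjective g) :
    (ModuleCat.shortComplexOfCompEqZero f g hfg.linearMap_comp_eq_zero).ShortExact where
  exact := (ShortComplex.ShortExact.moduleCat_exact_iff_function_exact _).mpr hfg
  mono_f := (ModuleCat.mono_iff_injective _).mpr hf
  epi_g := (ModuleCat.epi_iff_surjective _).mpr hg

lemma LinearMap.shortExact_baseChange {S : Type u} (R : Type u) {M N L : Type u} [CommRing S]
    [CommRing R] [Algebra S R]
    [Module.Flat S R] [AddCommGroup M] [Module S M] [AddCommGroup N]
    [Module S N] [AddCommGroup L] [Module S L] {f : M →ₗ[S] N} {g : N →ₗ[S] L}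
    (hf : Function.Injective f) (hfg : Function.Exact f g) (hg : Function.Surjective g) :
    Function.Injective (f.baseChange R) ∧ Function.Exact (f.baseChange R) (g.baseChange R) ∧
      Function.Surjective (g.baseChange R) :=
  ⟨Module.Flat.lTensor_preserves_injective_linearMap f hf, lTensor_exact R hfg hg,
    LinearMap.lTensor_surjective R hg⟩

lemma hasProjectiveDimensionLE_succ_iff {R M N L : Type u} [CommRing R] [AddCommGroup M]
    [Module R M] [AddCommGroup N] [Module R N] [AddCommGroup L] [Module R L] {f : M →ₗ[R] N}
    {g : N →ₗ[R] L} (hf : Function.Injective f) (hfg : Function.Exact f g)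
    (hg : Function.Surjective g) [hN : Module.Projective R N] (n : ℕ) :
    HasProjectiveDimensionLE (ModuleCat.of R L) (n + 1) ↔
      HasProjectiveDimensionLE (ModuleCat.of R M) n :=
  (LinearMap.shortExact_of_exact hf hfg hg).hasProjectiveDimensionLT_X₃_iff n
    ((IsProjective.iff_projective (R := R) N).1 hN)

lemma Module.exists_projective_surjective (R M : Type u) [CommRing R] [AddCommGroup M]
    [Module R M] :
    ∃ (P : Type u) (_ : AddCommGroup P) (_ : Module R P) (_ : Module.Projective R P)
      (p : P →ₗ[R] M), Function.Surjective p :=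
  ⟨M →₀ R, inferInstance, inferInstance, inferInstance, Finsupp.linearCombination R id,
    Finsupp.linearCombination_id_surjective R M⟩

lemma hasProjectiveDimensionLE_baseChange (S R : Type u) [CommRing S] [CommRing R] [Algebra S R]
    [Module.Flat S R] (n : ℕ) (M : Type u) [AddCommGroup M] [Module S M]
    [hM : HasProjectiveDimensionLE (ModuleCat.of S M) n] :
    HasProjectiveDimensionLE (ModuleCat.of R (R ⊗[S] M)) n := by
  induction n generalizing M with
  | zero =>
    rw [← projective_iff_hasProjectiveDimensionLE_zero, ← IsProjective.iff_projective] at hM ⊢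
    infer_instance
  | succ n ih =>
    obtain ⟨P, _, _, _, p, hp⟩ := Module.exists_projective_surjective S M
    have hker : Function.Exact (LinearMap.ker p).subtype p := p.exact_subtype_ker_map
    have hinj := (LinearMap.ker p).injective_subtype
    obtain ⟨h1, h2, h3⟩ := LinearMap.shortExact_baseChange R hinj hker hp
    have := (hasProjectiveDimensionLE_succ_iff hinj hker hp n).1 hM
    exact (hasProjectiveDimensionLE_succ_iff h1 h2 h3 n).2 (ih _)

end

section

open CategoryTheory Polynomial TensorProduct

variable {A M : Type u} [CommRing A] [AddCommGroup M] [Module A M] [Module A[X] M]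
  [IsScalarTower A A[X] M]

variable (A M) in
/-- The action of `A[X]` on `M`, as a map `A[X] ⊗ M → M`. -/
noncomputable def polynomialAction : A[X] ⊗[A] M →ₗ[A[X]] M :=
  LinearMap.liftBaseChange A[X] (LinearMap.id : M →ₗ[A] M)

variable (A M) in
/-- Multiplication by `X` on the polynomial ring minus multiplication by `X` on `M`. -/
noncomputable def polynomialRelation : A[X] ⊗[A] M →ₗ[A[X]] A[X] ⊗[A] M :=
  LinearMap.lsmul A[X] (A[X] ⊗[A] M) Polynomial.X -
    (Algebra.lsmul A A M (Polynomial.X : A[X])).baseChange A[X]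

lemma polynomialAction_tmul (p : A[X]) (m : M) : polynomialAction A M (p ⊗ₜ m) = p • m := by
  simp [polynomialAction]

lemma polynomialRelation_tmul (p : A[X]) (m : M) :
    polynomialRelation A M (p ⊗ₜ m) =
      (Polynomial.X * p) ⊗ₜ m - p ⊗ₜ ((Polynomial.X : A[X]) • m) := by
  simp [polynomialRelation, smul_tmul']

lemma polynomialAction_surjective : Function.Surjective (polynomialAction A M) := fun m =>
  ⟨1 ⊗ₜ m, by rw [polynomialAction_tmul, one_smul]⟩

lemma sub_one_tmul_mem_range_polynomialRelation (t : A[X] ⊗[A] M) :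
    t - 1 ⊗ₜ polynomialAction A M t ∈ LinearMap.range (polynomialRelation A M) := by
  induction t with
  | zero => simp
  | add x y hx hy =>
    rw [map_add, tmul_add, add_sub_add_comm]
    exact add_mem hx hy
  | tmul p m =>
    rw [polynomialAction_tmul]
    induction p using Polynomial.induction_on' generalizing m with
    | add p q hp hq =>
      rw [add_tmul, add_smul, tmul_add, add_sub_add_comm]
      exact add_mem (hp m) (hq m)
    | monomial n a =>
      induction n generalizing m with
      | zero =>
        rw [Polynomial.monomial_zero_left, ← Polynomial.algebraMap_eq, algebraMap_smul,
          Algebra.algebraMap_eq_smul_one, smul_tmul, sub_self]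
        exact zero_mem _
      | succ n ih =>
        have h := add_mem (LinearMap.mem_range_self (polynomialRelation A M)
          (Polynomial.monomial n a ⊗ₜ m)) (ih ((Polynomial.X : A[X]) • m))
        rwa [polynomialRelation_tmul, Polynomial.X_mul_monomial, smul_smul,
          Polynomial.monomial_mul_X, sub_add_sub_cancel] at h

lemma exact_polynomialRelation_polynomialAction :
    Function.Exact (polynomialRelation A M) (polynomialAction A M) := by
  intro t
  constructor
  · intro ht
    have := sub_one_tmul_mem_range_polynomialRelation t
    rwa [ht, tmul_zero, sub_zero] at this
  · rintro ⟨t, rfl⟩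
    induction t with
    | zero => simp
    | add x y hx hy => rw [map_add, map_add, hx, hy, add_zero]
    | tmul p m =>
      rw [polynomialRelation_tmul, map_sub, polynomialAction_tmul, polynomialAction_tmul,
        smul_smul, mul_comm, sub_self]

lemma polynomialRelation_injective : Function.Injective (polynomialRelation A M) := by
  set e := PolynomialModule.polynomialTensorProductLEquivPolynomialModule A M
  have he (p : A[X]) (m : M) (n : ℕ) : (e (p ⊗ₜ m)).coeff n = p.coeff n • m := by
    have : e (p ⊗ₜ m) = p • PolynomialModule.single A 0 m := by
      simp [e, PolynomialModule.polynomialTensorProductLEquivPolynomialModule]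
      rfl
    rw [this, PolynomialModule.smul_single_apply, if_pos (Nat.zero_le n), Nat.sub_zero]
  have hcoeff (t : A[X] ⊗[A] M) (n : ℕ) : (e (polynomialRelation A M t)).coeff (n + 1) =
      (e t).coeff n - (Polynomial.X : A[X]) • (e t).coeff (n + 1) := by
    induction t with
    | zero => simp
    | add x y hx hy =>
      simp only [map_add, PolynomialModule.coeff_add, Finsupp.add_apply, hx, hy, smul_add]
      abel
    | tmul p m =>
      rw [polynomialRelation_tmul, map_sub, eq_sub_iff_add_eq, he]
      have h := map_sub (PolynomialModule.coeffAddEquiv (R := A) (M := M))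
        (e ((Polynomial.X * p) ⊗ₜ m)) (e (p ⊗ₜ ((Polynomial.X : A[X]) • m)))
      simp only [PolynomialModule.coeffAddEquiv_apply] at h
      rw [h, Finsupp.sub_apply, he, he, he, Polynomial.coeff_X_mul, smul_comm, sub_add_cancel]
  rw [injective_iff_map_eq_zero]
  intro t ht
  have hstep (n : ℕ) : (e t).coeff n = (Polynomial.X : A[X]) • (e t).coeff (n + 1) := by
    have := hcoeff t n
    rw [ht, map_zero] at this
    exact (sub_eq_zero.mp this.symm)
  have hpow (k n : ℕ) : (e t).coeff n = (Polynomial.X : A[X]) ^ k • (e t).coeff (n + k) := by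
    induction k with
    | zero => simp
    | succ k ih => rw [ih, hstep (n + k), smul_smul, pow_succ, add_assoc]
  rw [← e.map_eq_zero_iff]
  apply PolynomialModule.coeff_injective
  ext n
  obtain ⟨k, hk⟩ := (e t).coeff.support.exists_nat_subset_range
  rw [hpow k n, Finsupp.notMem_support_iff.mp fun h => by simpa using hk h, smul_zero]
  rfl

lemma hasProjectiveDimensionLE_polynomial (n : ℕ)
    [HasProjectiveDimensionLE (ModuleCat.of A M) n] :
    HasProjectiveDimensionLE (ModuleCat.of A[X] M) (n + 1) := by
  have := hasProjectiveDimensionLE_baseChange A A[X] n M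
  exact (LinearMap.shortExact_of_exact polynomialRelation_injective
    exact_polynomialRelation_polynomialAction
    polynomialAction_surjective).hasProjectiveDimensionLT_X₃ (n + 1) this
      (hasProjectiveDimensionLT_of_ge _ (n + 1) _ (Nat.le_succ _))

end

section

open CategoryTheory TensorProduct

/-- All modules over `A` have projective dimension at most `n`. -/
def GlobalDimLE (A : Type u) [CommRing A] (n : ℕ) : Prop :=
  ∀ (M : Type u) [AddCommGroup M] [Module A M], HasProjectiveDimensionLE (ModuleCat.of A M) n

lemma GlobalDimLE.of_ringEquiv {A B : Type u} [CommRing A] [CommRing B] {n : ℕ}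
    (h : GlobalDimLE A n) (e : A ≃+* B) : GlobalDimLE B n := by
  intro M _ _
  let : Module A M := Module.compHom M e.toRingHom
  have := h M
  have := RingHomInvPair.of_ringEquiv e
  have := RingHomInvPair.of_ringEquiv e.symm
  let e' : ModuleCat.of A M ≃ₛₗ[RingHomClass.toRingHom e] ModuleCat.of B M :=
    { AddEquiv.refl M with map_smul' := fun _ _ => rfl }
  exact ModuleCat.hasProjectiveDimensionLE_of_semiLinearEquiv e e' n

lemma GlobalDimLE.of_field (K : Type u) [Field K] : GlobalDimLE K 0 := by
  intro M _ _
  rw [← projective_iff_hasProjectiveDimensionLE_zero, ← IsProjective.iff_projective]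
  infer_instance

open Polynomial in
lemma GlobalDimLE.polynomial {A : Type u} [CommRing A] {n : ℕ} (h : GlobalDimLE A n) :
    GlobalDimLE A[X] (n + 1) := by
  intro M _ _
  let : Module A M := Module.compHom M (algebraMap A A[X])
  have : IsScalarTower A A[X] M := IsScalarTower.of_algebraMap_smul fun _ _ => rfl
  have := h M
  exact hasProjectiveDimensionLE_polynomial n

/-- Hilbert's syzygy theorem. -/
theorem globalDimLE_mvPolynomial (K : Type u) [Field K] (s : ℕ) :
    GlobalDimLE (MvPolynomial (Fin s) K) s := by
  induction s with
  | zero => exact (GlobalDimLE.of_field K).of_ringEquiv (isEmptyRingEquiv K (Fin 0)).symm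
  | succ s ih => exact ih.polynomial.of_ringEquiv (finSuccEquiv K s).symm.toRingEquiv

lemma piScalarRight_mulVecLin_baseChange {S R : Type u} [CommRing S] [CommRing R] [Algebra S R]
    {m n : ℕ} (B : Matrix (Fin m) (Fin n) S) (t : R ⊗[S] (Fin n → S)) :
    piScalarRight S R R (Fin m) (B.mulVecLin.baseChange R t) =
      (B.map (algebraMap S R)).mulVecLin (piScalarRight S R R (Fin n) t) := by
  induction t with
  | zero => simp only [map_zero]
  | add x y hx hy => simp only [map_add, hx, hy]
  | tmul r v =>
    ext i
    simp only [LinearMap.baseChange_tmul, Matrix.mulVecLin_apply, piScalarRight_apply,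
      piScalarRightHom_tmul, Matrix.mulVec, dotProduct, Matrix.map_apply, Finset.sum_mul, map_sum,
      Algebra.smul_def, map_mul, mul_assoc]

/-- The cokernel of a base changed matrix is the base change of the cokernel. -/
lemma nonempty_baseChange_coker_equiv (S R : Type u) [CommRing S] [CommRing R]
    [Algebra S R] {m n : ℕ} (B : Matrix (Fin m) (Fin n) S) :
    Nonempty ((R ⊗[S] ((Fin m → S) ⧸ LinearMap.range B.mulVecLin)) ≃ₗ[R]
      (Fin m → R) ⧸ LinearMap.range (B.map (algebraMap S R)).mulVecLin) := by
  set e := piScalarRight S R R (Fin m) with he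
  set q := (LinearMap.range B.mulVecLin).mkQ with hq
  have hqs : Function.Surjective q := Submodule.mkQ_surjective _
  have hexact : Function.Exact (B.mulVecLin.baseChange R) (q.baseChange R) :=
    lTensor_exact R (LinearMap.exact_map_mkQ_range B.mulVecLin) hqs
  have hsurj : Function.Surjective (q.baseChange R ∘ₗ e.symm.toLinearMap) :=
    (LinearMap.lTensor_surjective R hqs).comp e.symm.surjective
  have hker : LinearMap.range (B.map (algebraMap S R)).mulVecLin =
      LinearMap.ker (q.baseChange R ∘ₗ e.symm.toLinearMap) := by
    ext w
    rw [LinearMap.mem_ker, LinearMap.comp_apply, hexact]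
    constructor
    · rintro ⟨v, rfl⟩
      refine ⟨(piScalarRight S R R (Fin n)).symm v, e.injective ?_⟩
      rw [piScalarRight_mulVecLin_baseChange, LinearEquiv.apply_symm_apply]
      exact (e.apply_symm_apply _).symm
    · rintro ⟨t, ht⟩
      refine ⟨piScalarRight S R R (Fin n) t, ?_⟩
      rw [← piScalarRight_mulVecLin_baseChange, ht]
      exact e.apply_symm_apply w
  exact ⟨(LinearMap.quotKerEquivOfSurjective _ hsurj).symm.trans
    (Submodule.quotEquivOfEq _ _ hker.symm)⟩

lemma GlobalDimLE.hasProjectiveDimensionLE_coker_map {S R : Type u} [CommRing S]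
    [CommRing R] [Algebra S R] [Module.Flat S R] {s : ℕ} (hS : GlobalDimLE S s)
    {m n : ℕ} (B : Matrix (Fin m) (Fin n) S) :
    HasProjectiveDimensionLE (ModuleCat.of R
      ((Fin m → R) ⧸ LinearMap.range (B.map (algebraMap S R)).mulVecLin)) s := by
  have := hS ((Fin m → S) ⧸ LinearMap.range B.mulVecLin)
  have := hasProjectiveDimensionLE_baseChange S R s ((Fin m → S) ⧸ LinearMap.range B.mulVecLin)
  obtain ⟨e⟩ := nonempty_baseChange_coker_equiv S R B
  exact ModuleCat.hasProjectiveDimensionLE_of_linearEquiv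
    (M := ModuleCat.of R (R ⊗[S] ((Fin m → S) ⧸ LinearMap.range B.mulVecLin))) e s

end

/-- If `φ : R^n → R^m` is given by a matrix of (not necessarily homogeneous)
polynomials of degree at most `d` and `M = coker φ`, then
`pd_R(M) ≤ (d+1) ↑^(d²+d-2) ((d+1)^(mn))`. -/
theorem projdim_coker_bound {K : Type*} [Field K] [IsAlgClosed K] {N : ℕ}
    (d : ℕ) (hd : 2 ≤ d) (m n : ℕ)
    (A : Matrix (Fin m) (Fin n) (MvPolynomial (Fin N) K))
    (hA : ∀ i j, (A i j).totalDegree ≤ d) :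
    ProjDimLE (MvPolynomial (Fin N) K)
      ((Fin m → MvPolynomial (Fin N) K) ⧸ LinearMap.range A.mulVecLin)
      (knuth (d + 1) (d ^ 2 + d - 2) ((d + 1) ^ (m * n))) := by
  obtain ⟨s, f, hs, hflat, hrange⟩ := exists_flat_aeval hd
    (fun p : Fin m × Fin n => A p.1 p.2) (fun p => hA p.1 p.2)
  rw [Fintype.card_prod, Fintype.card_fin, Fintype.card_fin] at hs
  choose B hB using fun i j => hrange (i, j)
  let : Algebra (MvPolynomial (Fin s) K) (MvPolynomial (Fin N) K) := (aeval f).toRingHom.toAlgebra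
  have : Module.Flat (MvPolynomial (Fin s) K) (MvPolynomial (Fin N) K) := hflat
  have hAB : A = (Matrix.of B).map (algebraMap _ _) := by
    ext1 i j
    exact (hB i j).symm
  have := (globalDimLE_mvPolynomial K s).hasProjectiveDimensionLE_coker_map
    (R := MvPolynomial (Fin N) K) (Matrix.of B)
  rw [← hAB] at this
  have := CategoryTheory.hasProjectiveDimensionLT_of_ge
    (ModuleCat.of (MvPolynomial (Fin N) K)
      ((Fin m → MvPolynomial (Fin N) K) ⧸ LinearMap.range A.mulVecLin)) _ _
    (Nat.succ_le_succ hs)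
  exact projDimLE_of_hasProjectiveDimensionLE _
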